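/- Let F ⊆ (ω)^ω be a game filter, s ∈ (ℕ) and X ∈ F with s ⪯ X, and suppose D ⊆ (ω)^{0*}_s is 0-dense in (X)^{0*}_s. Then there are t ∈ (X)^{1*}_s and Y ∈ (t,X) ∩ F such that the set {u ∈ (ℕ) : t ⪯ u and (u)^0_s ⊆ D} is 1-dense in (t,Y)^{1*}_s. -/

import Mathlib

namespace DualRamsey

/-- A partition: a set of pairwise disjoint nonempty blocks (subsets of ℕ). -/
def IsPartition (P : Set (Set ℕ)) : Prop :=
  (∀ b ∈ P, b.Nonempty) ∧ ∀ b ∈ P, ∀ c ∈ P, b ≠ c → Disjoint b c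

/-- The domain of a partition: the union of its blocks. -/
def pdom (P : Set (Set ℕ)) : Set ℕ := ⋃₀ P

/-- Membership in (ω)^ω : an infinite partition of ℕ. -/
def InfPart (X : Set (Set ℕ)) : Prop :=
  IsPartition X ∧ pdom X = Set.univ ∧ X.Infinite

/-- Membership in (ℕ) : a partition whose domain is {0, …, n−1} for some n. -/
def FinPart (s : Set (Set ℕ)) : Prop :=
  IsPartition s ∧ ∃ n : ℕ, pdom s = Set.Iio n

/-- `Coarser P Q` means P ⊑ Q : P is coarser than Q, i.e. every block p of P satisfies
that p ∩ dom(Q) is a union of sets of the form q ∩ dom(P) with q a block of Q. -/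
def Coarser (P Q : Set (Set ℕ)) : Prop :=
  ∀ p ∈ P, ∃ S ⊆ Q, p ∩ pdom Q = ⋃ q ∈ S, q ∩ pdom P

/-- `Segment s X` means s ⪯ X : for every block p of s there is a block q of X
with p = q ∩ dom(s). -/
def Segment (s X : Set (Set ℕ)) : Prop :=
  ∀ p ∈ s, ∃ q ∈ X, p = q ∩ pdom s

/-- For s ∈ (ℕ) with dom(s) = {0,…,n−1}, this is the number n. -/
noncomputable def finBound (s : Set (Set ℕ)) : ℕ := sInf {n | pdom s = Set.Iio n}

/-- s* := s ∪ {{n}} where dom(s) = {0,…,n−1}. -/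
noncomputable def sStar (s : Set (Set ℕ)) : Set (Set ℕ) := insert {finBound s} s

/-- The dual Ellentuck neighbourhood (s,X) := {Y ∈ (ω)^ω : s ⪯ Y and Y ⊑ X}. -/
def EllNbhd (s X : Set (Set ℕ)) : Set (Set (Set ℕ)) :=
  {Y | InfPart Y ∧ Segment s Y ∧ Coarser Y X}

/-- (s,X)^n := {u ∈ (ℕ) : |u| = n, s ⪯ u, u* ⊑ X}. -/
def nseg (s X : Set (Set ℕ)) (n : ℕ) : Set (Set (Set ℕ)) :=
  {u | FinPart u ∧ u.ncard = n ∧ Segment s u ∧ Coarser (sStar u) X}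

/-- (s,ω)^n := {u ∈ (ℕ) : |u| = n, s ⪯ u} (ω viewed as the partition into singletons). -/
def nsegOmega (s : Set (Set ℕ)) (n : ℕ) : Set (Set (Set ℕ)) :=
  {u | FinPart u ∧ u.ncard = n ∧ Segment s u}

/-- a and b lie in a common block of P. -/
def sameBlock (P : Set (Set ℕ)) (a b : ℕ) : Prop := ∃ p ∈ P, a ∈ p ∧ b ∈ p

/-- P ⊓ Q : the finest partition coarser than both P and Q, with
dom(P ⊓ Q) = dom(P) ∪ dom(Q); its blocks are the classes of the equivalence
relation generated by "lying in a common block of P or of Q". -/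
def pmeet (P Q : Set (Set ℕ)) : Set (Set ℕ) :=
  {b | ∃ a ∈ pdom P ∪ pdom Q,
    b = {c | Relation.EqvGen (fun u v => sameBlock P u v ∨ sameBlock Q u v) a c}}

/-- P ⊑* Q : P is almost coarser than Q, i.e. there is a partition R with finite
domain such that R ⊓ P ⊑ Q. -/
def AlmostCoarser (P Q : Set (Set ℕ)) : Prop :=
  ∃ R, IsPartition R ∧ (pdom R).Finite ∧ Coarser (pmeet R P) Q

/-- A filter on (ω)^ω. -/
structure IsPFilter (F : Set (Set (Set ℕ))) : Prop where
  mem_infPart : ∀ X ∈ F, InfPart X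
  empty_not_mem : ∅ ∉ F
  upward : ∀ X ∈ F, ∀ Y, InfPart Y → Coarser X Y → Y ∈ F
  meet_infPart : ∀ X ∈ F, ∀ Y ∈ F, InfPart (pmeet X Y)
  meet_mem : ∀ X ∈ F, ∀ Y ∈ F, pmeet X Y ∈ F

/-- An ultrafilter on (ω)^ω : a filter not properly contained in any other filter. -/
def IsPUltrafilter (F : Set (Set (Set ℕ))) : Prop :=
  IsPFilter F ∧ ∀ G, IsPFilter G → F ⊆ G → F = G

/-- The segment colouring property. -/
def HasSCP (F : Set (Set (Set ℕ))) : Prop :=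
  ∀ s, FinPart s → ∀ X ∈ F, Coarser s X → ∀ k r : ℕ, 1 ≤ s.ncard + k → 1 ≤ r →
    ∀ π : Set (Set ℕ) → ℕ, (∀ u ∈ nseg s X (s.ncard + k), π u < r) →
      ∃ Y ∈ EllNbhd s X, Y ∈ F ∧
        ∀ u ∈ nseg s Y (s.ncard + k), ∀ v ∈ nseg s Y (s.ncard + k), π u = π v

/-- `IsLCondWith E p s Xw` : p is an L*_E-condition with stem s and witness family Xw. -/
def IsLCondWith (E : Set (Set (Set ℕ))) (p : Set (Set (Set ℕ))) (s : Set (Set ℕ))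
    (Xw : Set (Set ℕ) → Set (Set ℕ)) : Prop :=
  (∀ t ∈ p, FinPart t) ∧
  s ∈ p ∧ (∀ t ∈ p, Segment s t) ∧
  (∀ t ∈ p, Xw t ∈ E) ∧
  (∀ t ∈ p, Coarser (sStar t) (Xw t)) ∧
  (∀ t ∈ p, {u | u ∈ p ∧ Segment t u ∧ u.ncard = t.ncard + 1}
      = nseg (sStar t) (Xw t) (t.ncard + 1)) ∧
  (∀ t ∈ p, ∀ u ∈ p, Segment t u → EllNbhd u (Xw u) ⊆ EllNbhd t (Xw t)) ∧
  (∀ t ∈ p, ∀ u ∈ p, pdom t = pdom u → Coarser t u → Xw t = Xw u)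

/-- X is a branch of the condition p with stem s. -/
def IsBranch (p : Set (Set (Set ℕ))) (s : Set (Set ℕ)) (X : Set (Set ℕ)) : Prop :=
  ∀ t, FinPart t → Segment s t → Coarser (sStar t) X → t ∈ p

/-- F is diagonalizable: every L*_F-condition has a branch in F. -/
def Diagonalizable (F : Set (Set (Set ℕ))) : Prop :=
  ∀ p s Xw, IsLCondWith F p s Xw → ∃ X ∈ F, IsBranch p s X

/-- A Ramsey* ultrafilter: a diagonalizable scp-filter. -/
def RamseyStar (F : Set (Set (Set ℕ))) : Prop :=
  IsPFilter F ∧ HasSCP F ∧ Diagonalizable F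

/-- O is F-open: a union of nonempty dual Ellentuck neighbourhoods (s,X) with X ∈ F. -/
def FOpen (F O : Set (Set (Set ℕ))) : Prop :=
  ∃ I : Set ((Set (Set ℕ)) × (Set (Set ℕ))),
    (∀ q ∈ I, FinPart q.1 ∧ q.2 ∈ F ∧ (EllNbhd q.1 q.2).Nonempty) ∧
    O = ⋃ q ∈ I, EllNbhd q.1 q.2

/-- (s,X) is good with respect to the F-open set O. -/
def FGood (F O : Set (Set (Set ℕ))) (s X : Set (Set ℕ)) : Prop :=
  ∃ Y ∈ EllNbhd s X, Y ∈ F ∧ EllNbhd s Y ⊆ O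

/-- (s,X) is ugly with respect to O: (t*,X) is bad for every t ∈ (ℕ) with
s ⪯ t*, t* ⊑ X and |t| = |s|. -/
def FUgly (F O : Set (Set (Set ℕ))) (s X : Set (Set ℕ)) : Prop :=
  ∀ t, FinPart t → Segment s (sStar t) → Coarser (sStar t) X → t.ncard = s.ncard →
    ¬ FGood F O (sStar t) X

/-- p is uniform with uniformity witness X (X = cu(p)). -/
def UniformWith (F : Set (Set (Set ℕ))) (p : Set (Set (Set ℕ)))
    (Xw : Set (Set ℕ) → Set (Set ℕ)) (X : Set (Set ℕ)) : Prop :=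
  X ∈ F ∧ ∀ t ∈ p, EllNbhd t X = EllNbhd t (Xw t)

/-- (X) := {Y ∈ (ω)^ω : Y ⊑ X}. -/
def coarsenings (X : Set (Set ℕ)) : Set (Set (Set ℕ)) :=
  {Y | InfPart Y ∧ Coarser Y X}

/-- A ⊆ (ω)^ω has the dual Ramsey property. -/
def IsDualRamsey (A : Set (Set (Set ℕ))) : Prop :=
  ∃ X, InfPart X ∧ (coarsenings X ⊆ A ∨ coarsenings X ∩ A = ∅)

/-- A ⊆ (ω)^ω is completely dual Ramsey. -/
def CompletelyDualRamsey (A : Set (Set (Set ℕ))) : Prop :=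
  ∀ s X, FinPart s → InfPart X → (EllNbhd s X).Nonempty →
    ∃ Y ∈ EllNbhd s X, (EllNbhd s Y ⊆ A ∨ EllNbhd s Y ∩ A = ∅)

/- ### Coding between reals and partitions -/

/-- The hypotheses on the fixed pairing function ♭ : it is (induced by) a bijection
between two-element subsets of ℕ and ℕ. -/
def FlatBijection (flat : ℕ → ℕ → ℕ) : Prop :=
  (∀ m n, flat m n = flat n m) ∧
  (∀ a b c d, a ≠ b → c ≠ d → flat a b = flat c d → ({a, b} : Set ℕ) = {c, d}) ∧
  (∀ k, ∃ a b, a ≠ b ∧ flat a b = k)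

/-- trans(x): the codes ♭({a,b}) of pairs {a,b} connected by a finite chain through x. -/
def ptrans (flat : ℕ → ℕ → ℕ) (x : Set ℕ) : Set ℕ :=
  {k | ∃ m : ℕ, ∃ f : ℕ → ℕ, 1 ≤ m ∧ f 0 ≠ f m ∧ k = flat (f 0) (f m) ∧
    ∀ i < m, flat (f i) (f (i + 1)) ∈ x}

/-- The equivalence relation n ∼ m iff n = m or ♭({n,m}) ∈ trans(x). -/
def cpRel (flat : ℕ → ℕ → ℕ) (x : Set ℕ) (n m : ℕ) : Prop :=
  n = m ∨ flat n m ∈ ptrans flat x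

/-- cp(x): the partition of ℕ whose blocks are the classes of cpRel. -/
def cp (flat : ℕ → ℕ → ℕ) (x : Set ℕ) : Set (Set ℕ) :=
  {b | ∃ n : ℕ, b = {m | cpRel flat x n m}}

/-- pc(X): the partition code of X. -/
def pcode (flat : ℕ → ℕ → ℕ) (X : Set (Set ℕ)) : Set ℕ :=
  {k | ∃ n m, n ≠ m ∧ sameBlock X n m ∧ k = flat n m}

/- ### The game G_F -/

/-- A move of player I: a pair ⟨t, Y⟩. -/
abbrev MoveI := (Set (Set ℕ)) × (Set (Set ℕ))

/-- The play (t, Y, X) follows the strategy σ of player I (σ reads off the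
previous moves of player II). -/
def Follows (σ : List (Set (Set ℕ)) → MoveI) (t Y X : ℕ → Set (Set ℕ)) : Prop :=
  ∀ n, σ (List.ofFn fun i : Fin n => X i) = (t n, Y n)

/-- Player I's n-th move in the play (t,Y,X) is legal. -/
def LegalI (F : Set (Set (Set ℕ))) (t Y X : ℕ → Set (Set ℕ)) (n : ℕ) : Prop :=
  FinPart (t n) ∧ Y n ∈ F ∧ (EllNbhd (sStar (t n)) (Y n)).Nonempty ∧
  ∀ m, n = m + 1 →
    Segment (sStar (t m)) (sStar (t n)) ∧ Coarser (sStar (t n)) (X m) ∧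
    (t n).ncard = (t m).ncard + 1

/-- Player II's n-th move in the play (t,Y,X) is legal. -/
def LegalII (F : Set (Set (Set ℕ))) (t Y X : ℕ → Set (Set ℕ)) (n : ℕ) : Prop :=
  X n ∈ F ∧ X n ∈ EllNbhd (sStar (t n)) (Y n)

/-- σ is a winning strategy for player I in G_F: against legal play of II it always
produces legal moves, and in every legal play following σ player I wins, i.e. any
Y ∈ (ω)^ω with t_n ⪯ Y for all n is not in F. -/
def WinningStratI (F : Set (Set (Set ℕ))) (σ : List (Set (Set ℕ)) → MoveI) : Prop :=
  ∀ t Y X, Follows σ t Y X →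
    (∀ n, (∀ m < n, LegalII F t Y X m) → LegalI F t Y X n) ∧
    ((∀ n, LegalII F t Y X n) →
      ∀ Z, InfPart Z → (∀ n, Segment (t n) Z) → Z ∉ F)

/-- A game filter: an ultrafilter such that player I has no winning strategy in G_F. -/
def GameFilter (F : Set (Set (Set ℕ))) : Prop :=
  IsPUltrafilter F ∧ ∀ σ, ¬ WinningStratI F σ

/- ### Density notions for the appendix -/

/-- (t)^0_s := {u ∈ (ℕ) : dom(u) = dom(t), s ⪯ u, u ⊑ t, |u| = |s|}. -/
def iseg0 (s t : Set (Set ℕ)) : Set (Set (Set ℕ)) :=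
  {u | FinPart u ∧ pdom u = pdom t ∧ Segment s u ∧ Coarser u t ∧ u.ncard = s.ncard}

/-- K ⊆ (ℕ) is dense in (t,X): for every Y ∈ (t,X) ∩ F there is u ∈ K with
t ⪯ u* and u* ⊑ Y. -/
def DenseIn (F : Set (Set (Set ℕ))) (K : Set (Set (Set ℕ))) (t X : Set (Set ℕ)) : Prop :=
  ∀ Y ∈ EllNbhd t X, Y ∈ F → ∃ u ∈ K, Segment t (sStar u) ∧ Coarser (sStar u) Y

/-- D is 0-dense in (X)^{0*}_s: for every Y ∈ (s,X) ∩ F there is u ∈ D with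
s ⪯ u* and u* ⊑ Y. -/
def ZeroDense (F : Set (Set (Set ℕ))) (D : Set (Set (Set ℕ))) (s X : Set (Set ℕ)) : Prop :=
  ∀ Y ∈ EllNbhd s X, Y ∈ F → ∃ u ∈ D, Segment s (sStar u) ∧ Coarser (sStar u) Y

/-- (t,X)^{k*}_s := {u ∈ (ℕ) : t ⪯ u*, u* ⊑ X, |u| = |s| + k}. -/
def tseg (s t X : Set (Set ℕ)) (k : ℕ) : Set (Set (Set ℕ)) :=
  {u | FinPart u ∧ Segment t (sStar u) ∧ Coarser (sStar u) X ∧ u.ncard = s.ncard + k}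

/-- E is k-dense in (t,X)^{k*}_s: for every Y ∈ (t,X) ∩ F, (t,Y)^{k*}_s ∩ E ≠ ∅. -/
def KDense (F : Set (Set (Set ℕ))) (E : Set (Set (Set ℕ))) (s t X : Set (Set ℕ))
    (k : ℕ) : Prop :=
  ∀ Y ∈ EllNbhd t X, Y ∈ F → (tseg s t Y k ∩ E).Nonempty

/- ### Combinatorics of equivalence relations on ℕ -/

/-- `r` and `q` coincide on `{0, …, n - 1}`. -/
def Agree (r q : Setoid ℕ) (n : ℕ) : Prop := ∀ a < n, ∀ b < n, r a b ↔ q a b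

/-- `r` is contained in `q` on `{0, …, n - 1}`. -/
def LeOn (r q : Setoid ℕ) (n : ℕ) : Prop := ∀ a < n, ∀ b < n, r a b → q a b

/-- `k` is the least element of its class. -/
def IsFirst (r : Setoid ℕ) (k : ℕ) : Prop := ∀ j < k, ¬ r j k

/-- Every class of `r` meeting `{0, …, l - 1}` already meets `{0, …, k - 1}`. -/
def NoNew (r : Setoid ℕ) (k l : ℕ) : Prop := ∀ d < l, ∃ c < k, r c d

/-- Exactly one class of `r` meets `{0, …, l - 1}` but not `{0, …, k - 1}`. -/
def OneNew (r : Setoid ℕ) (k l : ℕ) : Prop :=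
  ∃ a < l, k ≤ a ∧ (∀ c < k, ¬ r c a) ∧ ∀ d < l, (∃ c < k, r c d) ∨ r a d

/-- `r` has infinitely many classes. -/
def InfClasses (r : Setoid ℕ) : Prop := ∀ n, ∃ k, n ≤ k ∧ IsFirst r k

theorem Agree.symm {r q : Setoid ℕ} {n : ℕ} (h : Agree r q n) : Agree q r n :=
  fun a ha b hb => (h a ha b hb).symm

theorem Agree.trans {r q p : Setoid ℕ} {n : ℕ} (h : Agree r q n) (h' : Agree q p n) :
    Agree r p n :=
  fun a ha b hb => (h a ha b hb).trans (h' a ha b hb)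

theorem Agree.mono {r q : Setoid ℕ} {m n : ℕ} (h : Agree r q n) (hmn : m ≤ n) : Agree r q m :=
  fun a ha b hb => h a (ha.trans_le hmn) b (hb.trans_le hmn)

theorem Agree.refl (r : Setoid ℕ) (n : ℕ) : Agree r r n := fun _ _ _ _ => Iff.rfl

theorem Agree.leOn {r q : Setoid ℕ} {n : ℕ} (h : Agree r q n) : LeOn r q n :=
  fun a ha b hb => (h a ha b hb).1

theorem leOn_of_le {r q : Setoid ℕ} (h : r ≤ q) (n : ℕ) : LeOn r q n :=
  fun _ _ _ _ hab => h hab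

theorem LeOn.trans {r q p : Setoid ℕ} {n : ℕ} (h : LeOn r q n) (h' : LeOn q p n) :
    LeOn r p n :=
  fun a ha b hb hab => h' a ha b hb (h a ha b hb hab)

theorem LeOn.mono {r q : Setoid ℕ} {m n : ℕ} (h : LeOn r q n) (hmn : m ≤ n) : LeOn r q m :=
  fun a ha b hb => h a (ha.trans_le hmn) b (hb.trans_le hmn)

theorem IsFirst.anti {r q : Setoid ℕ} {k : ℕ} (h : r ≤ q) (hk : IsFirst q k) : IsFirst r k :=
  fun j hj hr => hk j hj (h hr)

theorem InfClasses.anti {r q : Setoid ℕ} (h : r ≤ q) (hq : InfClasses q) : InfClasses r :=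
  fun n => let ⟨k, hk, hl⟩ := hq n; ⟨k, hk, hl.anti h⟩

open Classical in
/-- The least element of the class of `a`. -/
noncomputable def rep (r : Setoid ℕ) (a : ℕ) : ℕ := Nat.find (⟨a, r.refl a⟩ : ∃ b, r a b)

open Classical in
theorem rel_rep (r : Setoid ℕ) (a : ℕ) : r a (rep r a) :=
  Nat.find_spec (⟨a, r.refl a⟩ : ∃ b, r a b)

open Classical in
theorem rep_le_of_rel {r : Setoid ℕ} {a b : ℕ} (h : r a b) : rep r a ≤ b :=
  Nat.find_min' _ h

theorem rep_le (r : Setoid ℕ) (a : ℕ) : rep r a ≤ a := rep_le_of_rel (r.refl a)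

theorem rep_eq_of_rel {r : Setoid ℕ} {a b : ℕ} (h : r a b) : rep r a = rep r b :=
  le_antisymm (rep_le_of_rel (r.trans h (rel_rep r b)))
    (rep_le_of_rel (r.trans (r.symm h) (rel_rep r a)))

theorem rel_of_rep_eq {r : Setoid ℕ} {a b : ℕ} (h : rep r a = rep r b) : r a b :=
  r.trans (rel_rep r a) (h ▸ r.symm (rel_rep r b))

theorem rep_rep (r : Setoid ℕ) (a : ℕ) : rep r (rep r a) = rep r a :=
  (rep_eq_of_rel (rel_rep r a)).symm

theorem IsFirst.rep_eq {r : Setoid ℕ} {k : ℕ} (h : IsFirst r k) : rep r k = k := by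
  by_contra hne
  exact h _ (lt_of_le_of_ne (rep_le r k) hne) (r.symm (rel_rep r k))

theorem isFirst_rep (r : Setoid ℕ) (a : ℕ) : IsFirst r (rep r a) := fun _ hj h =>
  absurd (rep_le_of_rel (r.trans (rel_rep r a) (r.symm h))) (not_le.2 hj)

/-- The relation `r` on `{0, …, n - 1}`, all other points being isolated. -/
def low (r : Setoid ℕ) (n : ℕ) : Setoid ℕ where
  r a b := a = b ∨ (a < n ∧ b < n ∧ r a b)
  iseqv :=
    { refl := fun _ => Or.inl rfl
      symm := by
        rintro a b (rfl | ⟨ha, hb, h⟩)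
        · exact Or.inl rfl
        · exact Or.inr ⟨hb, ha, r.symm h⟩
      trans := by
        rintro a b c (rfl | ⟨ha, hb, h⟩) (rfl | ⟨hb', hc, h'⟩)
        · exact Or.inl rfl
        · exact Or.inr ⟨hb', hc, h'⟩
        · exact Or.inr ⟨ha, hb, h⟩
        · exact Or.inr ⟨ha, hc, r.trans h h'⟩ }

theorem low_apply {r : Setoid ℕ} {n a b : ℕ} :
    low r n a b ↔ a = b ∨ (a < n ∧ b < n ∧ r a b) := Iff.rfl

theorem agree_low (r : Setoid ℕ) (n : ℕ) : Agree r (low r n) n := by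
  intro a ha b hb
  rw [low_apply]
  constructor
  · exact fun h => Or.inr ⟨ha, hb, h⟩
  · rintro (rfl | ⟨-, -, h⟩)
    · exact r.refl _
    · exact h

theorem isFirst_low (r : Setoid ℕ) (n : ℕ) : IsFirst (low r n) n := by
  rintro j hj (h | ⟨-, h, -⟩) <;> omega

theorem IsFirst.sup_low {w : Setoid ℕ} {k n : ℕ} (hk : IsFirst w k) (hn : n ≤ k)
    (g : Setoid ℕ) : IsFirst (w ⊔ low g n) k := by
  intro j hj h
  have hle : w ⊔ low g n ≤ Setoid.ker (fun a => w a k) := by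
    refine sup_le ?_ ?_
    · intro a b hab
      exact propext ⟨fun h' => w.trans (w.symm hab) h', fun h' => w.trans hab h'⟩
    · rintro a b (rfl | ⟨ha, hb, -⟩)
      · exact rfl
      · exact propext ⟨fun h' => absurd h' (hk a (by omega)), fun h' => absurd h' (hk b (by omega))⟩
  have h2 : w j k = w k k := hle h
  exact hk j hj (h2 ▸ w.refl k)

/-- The finest coarsening of `Y` extending `τ` on `{0, …, n - 1}`. -/
def glue (Y τ : Setoid ℕ) (n : ℕ) (h : LeOn Y τ n) : Setoid ℕ where
  r a b := Y a b ∨ ∃ c < n, ∃ d < n, Y a c ∧ τ c d ∧ Y d b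
  iseqv :=
    { refl := fun a => Or.inl (Y.refl a)
      symm := by
        rintro a b (h | ⟨c, hc, d, hd, h1, h2, h3⟩)
        · exact Or.inl (Y.symm h)
        · exact Or.inr ⟨d, hd, c, hc, Y.symm h3, τ.symm h2, Y.symm h1⟩
      trans := by
        rintro a b e (h1 | ⟨c, hc, d, hd, h1, h2, h3⟩) (h1' | ⟨c', hc', d', hd', h1', h2', h3'⟩)
        · exact Or.inl (Y.trans h1 h1')
        · exact Or.inr ⟨c', hc', d', hd', Y.trans h1 h1', h2', h3'⟩
        · exact Or.inr ⟨c, hc, d, hd, h1, h2, Y.trans h3 h1'⟩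
        · exact Or.inr ⟨c, hc, d', hd', h1,
            τ.trans h2 (τ.trans (h d hd c' hc' (Y.trans h3 h1')) h2'), h3'⟩ }

theorem le_glue {Y τ : Setoid ℕ} {n : ℕ} (h : LeOn Y τ n) : Y ≤ glue Y τ n h :=
  fun _ _ hab => Or.inl hab

theorem agree_glue {Y τ : Setoid ℕ} {n : ℕ} (h : LeOn Y τ n) : Agree τ (glue Y τ n h) n := by
  intro a ha b hb
  constructor
  · exact fun hab => Or.inr ⟨a, ha, b, hb, Y.refl a, hab, Y.refl b⟩
  · rintro (hab | ⟨c, hc, d, hd, h1, h2, h3⟩)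
    · exact h a ha b hb hab
    · exact τ.trans (h a ha c hc h1) (τ.trans h2 (h d hd b hb h3))

theorem glue_le {Y τ : Setoid ℕ} {n : ℕ} (h : LeOn Y τ n) :
    glue Y τ n h ≤ Y ⊔ low ⊤ n := by
  rintro a b (hab | ⟨c, hc, d, hd, h1, h2, h3⟩)
  · exact le_sup_left (a := Y) hab
  · have h1' : (Y ⊔ low ⊤ n) a c := le_sup_left (a := Y) h1
    have h2' : (Y ⊔ low ⊤ n) c d := le_sup_right (a := Y) (Or.inr ⟨hc, hd, trivial⟩)
    have h3' : (Y ⊔ low ⊤ n) d b := le_sup_left (a := Y) h3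
    exact Setoid.trans' _ h1' (Setoid.trans' _ h2' h3')

open Classical in
/-- A representative function whose kernel lies between `Y` and `Z`, equals `Y` on the classes
of `Y` meeting `{0, …, n - 1}` and merges all other classes as `Z` does. -/
noncomputable def splitRep (Y Z : Setoid ℕ) (n a : ℕ) : ℕ :=
  if rep Y a < n then rep Y a else rep Z a

/-- The relation given by `splitRep`. -/
noncomputable def split (Y Z : Setoid ℕ) (n : ℕ) : Setoid ℕ := Setoid.ker (splitRep Y Z n)

theorem split_apply {Y Z : Setoid ℕ} {n a b : ℕ} :
    split Y Z n a b ↔ splitRep Y Z n a = splitRep Y Z n b := Iff.rfl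

theorem le_split {Y Z : Setoid ℕ} (h : Y ≤ Z) (n : ℕ) : Y ≤ split Y Z n := by
  intro a b hab
  rw [split_apply, splitRep, splitRep, rep_eq_of_rel hab, rep_eq_of_rel (h hab)]

theorem rel_splitRep {Y Z : Setoid ℕ} (h : Y ≤ Z) (n a : ℕ) : Z a (splitRep Y Z n a) := by
  unfold splitRep
  split_ifs
  · exact h (rel_rep Y a)
  · exact rel_rep Z a

theorem split_le {Y Z : Setoid ℕ} (h : Y ≤ Z) (n : ℕ) : split Y Z n ≤ Z := by
  intro a b hab
  have h1 := rel_splitRep h n a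
  rw [split_apply.1 hab] at h1
  exact Z.trans h1 (Z.symm (rel_splitRep h n b))

theorem agree_split (Y Z : Setoid ℕ) (n : ℕ) : Agree Y (split Y Z n) n := by
  intro a ha b hb
  have ha' := (rep_le Y a).trans_lt ha
  have hb' := (rep_le Y b).trans_lt hb
  rw [split_apply, splitRep, splitRep, if_pos ha', if_pos hb']
  exact ⟨rep_eq_of_rel, rel_of_rep_eq⟩

theorem splitRep_le (Y Z : Setoid ℕ) (n a : ℕ) : splitRep Y Z n a ≤ a := by
  unfold splitRep
  split_ifs
  · exact rep_le Y a
  · exact rep_le Z a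

theorem splitRep_eq_rep_of_le {Y Z : Setoid ℕ} {n a : ℕ} (h : n ≤ splitRep Y Z n a) :
    splitRep Y Z n a = rep Z a := by
  unfold splitRep at *
  split_ifs at * with h'
  · omega
  · rfl

theorem splitRep_splitRep {Y Z : Setoid ℕ} (h : Y ≤ Z) (n a : ℕ) :
    splitRep Y Z n (splitRep Y Z n a) = splitRep Y Z n a := by
  by_cases h1 : rep Y a < n
  · have : splitRep Y Z n a = rep Y a := if_pos h1
    rw [this, splitRep, rep_rep, if_pos h1]
  · have h2 : splitRep Y Z n a = rep Z a := if_neg h1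
    have h3 : rep Z a ≤ rep Y (rep Z a) :=
      rep_le_of_rel (Z.trans (rel_rep Z a) (h (rel_rep Y _)))
    have h4 : rep Y (rep Z a) = rep Z a := le_antisymm (rep_le _ _) h3
    rw [h2, splitRep, rep_rep, h4, ite_self]

theorem split_splitRep {Y Z : Setoid ℕ} (h : Y ≤ Z) (n a : ℕ) :
    split Y Z n a (splitRep Y Z n a) :=
  (splitRep_splitRep h n a).symm

/-- A finite relation extending `Z` on `{0, …, n - 1}` and coarser than `split Y Z n` is coarser
than `Z`. -/
theorem LeOn.of_split {Y Z ρ : Setoid ℕ} {n l : ℕ} (h : Y ≤ Z)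
    (hZ : Agree Z ρ n) (hρ : LeOn (split Y Z n) ρ l) : LeOn Z ρ l := by
  intro a ha b hb hab
  have hrel : ∀ x < l, ρ x (splitRep Y Z n x) := fun x hx =>
    hρ x hx _ ((splitRep_le Y Z n x).trans_lt hx) (split_splitRep h n x)
  have hZab : Z (splitRep Y Z n a) (splitRep Y Z n b) :=
    Z.trans (Z.symm (rel_splitRep h n a)) (Z.trans hab (rel_splitRep h n b))
  refine ρ.trans (hrel a ha) (ρ.trans ?_ (ρ.symm (hrel b hb)))
  have hle : ∀ x, rep Z x ≤ splitRep Y Z n x := fun x => rep_le_of_rel (rel_splitRep h n x)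
  have hrep : rep Z a = rep Z b := rep_eq_of_rel hab
  by_cases h1 : splitRep Y Z n a < n
  · by_cases h2 : splitRep Y Z n b < n
    · exact (hZ _ h1 _ h2).1 hZab
    · have := splitRep_eq_rep_of_le (not_lt.1 h2)
      have := hle a
      omega
  · have h3 := splitRep_eq_rep_of_le (not_lt.1 h1)
    have h4 := hle b
    have h5 := splitRep_eq_rep_of_le (Y := Y) (Z := Z) (n := n) (a := b) (by omega)
    rw [h3, h5, hrep]

theorem IsFirst.of_split {Y Z : Setoid ℕ} {n l : ℕ} (h : Y ≤ Z) (hnl : n ≤ l)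
    (hl : IsFirst (split Y Z n) l) : IsFirst Z l := by
  have h1 : splitRep Y Z n l = l := by
    by_contra hne
    exact hl _ (lt_of_le_of_ne (splitRep_le Y Z n l) hne)
      ((split Y Z n).symm (split_splitRep h n l))
  have h2 := splitRep_eq_rep_of_le (Y := Y) (Z := Z) (n := n) (a := l) (by omega)
  rw [← h1, h2]
  exact isFirst_rep Z l

theorem InfClasses.exists_next {r : Setoid ℕ} (h : InfClasses r) (n : ℕ) :
    ∃ k, n ≤ k ∧ IsFirst r k ∧ ∀ j, n ≤ j → j < k → ¬ IsFirst r j := by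
  classical
  have hex := h n
  exact ⟨Nat.find hex, (Nat.find_spec hex).1, (Nat.find_spec hex).2,
    fun j hj hjk hl => Nat.find_min hex hjk ⟨hj, hl⟩⟩

theorem noNew_of_forall_not_isFirst {r : Setoid ℕ} {n k : ℕ}
    (h : ∀ j, n ≤ j → j < k → ¬ IsFirst r j) : NoNew r n k := by
  intro d hd
  refine ⟨rep r d, ?_, r.symm (rel_rep r d)⟩
  by_contra hlt
  exact h _ (not_lt.1 hlt) ((rep_le r d).trans_lt hd) (isFirst_rep r d)

theorem NoNew.mono {r q : Setoid ℕ} {k l : ℕ} (h : NoNew r k l) (hkl : k ≤ l)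
    (hrq : LeOn r q l) : NoNew q k l := fun d hd =>
  let ⟨c, hc, h1⟩ := h d hd
  ⟨c, hc, hrq c (hc.trans_le hkl) d hd h1⟩

/-- Two relations on `{0, …, l - 1}` without new classes above `k` that agree below `k` are equal
as soon as one contains the other. -/
theorem NoNew.agree {r q : Setoid ℕ} {k l : ℕ} (h : NoNew r k l) (hkl : k ≤ l)
    (hrq : LeOn r q l) (hk : Agree r q k) : Agree r q l := by
  intro a ha b hb
  refine ⟨hrq a ha b hb, fun hab => ?_⟩
  obtain ⟨c, hc, hca⟩ := h a ha
  obtain ⟨d, hd, hdb⟩ := h b hb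
  have h1 : q c d := q.trans (hrq c (by omega) a ha hca)
    (q.trans hab (q.symm (hrq d (by omega) b hb hdb)))
  exact r.trans (r.symm hca) (r.trans ((hk c hc d hd).2 h1) hdb)

/-- Every element of `iseg0` of the finite partition given by `ρ` and `l` satisfies `D`. -/
def Line (X : Setoid ℕ) (D : Setoid ℕ → ℕ → Prop) (ns : ℕ) (ρ : Setoid ℕ) (l : ℕ) : Prop :=
  ∀ ρ', Agree X ρ' ns → LeOn ρ ρ' l → NoNew ρ' ns l → D ρ' l

open Classical in
/-- Replace every point by the least element `c` of its class, and then by `f c` if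
`n ≤ c < k`. -/
noncomputable def subst (W : Setoid ℕ) (n k : ℕ) (f : ℕ → ℕ) (a : ℕ) : ℕ :=
  if n ≤ rep W a ∧ rep W a < k then f (rep W a) else rep W a

theorem subst_of_rep_lt {W : Setoid ℕ} {n k : ℕ} {f : ℕ → ℕ} {a : ℕ} (h : rep W a < n) :
    subst W n k f a = rep W a := if_neg (by omega)

theorem subst_of_lt {W : Setoid ℕ} {n k : ℕ} {f : ℕ → ℕ} {a : ℕ} (h : a < n) :
    subst W n k f a = rep W a := subst_of_rep_lt ((rep_le W a).trans_lt h)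

theorem subst_of_le {W : Setoid ℕ} {n k : ℕ} {f : ℕ → ℕ} {a : ℕ} (h : n ≤ rep W a)
    (ha : a < k) : subst W n k f a = f (rep W a) := if_pos ⟨h, (rep_le W a).trans_lt ha⟩

theorem subst_eq_of_rel {W : Setoid ℕ} {n k : ℕ} {f : ℕ → ℕ} {a b : ℕ} (h : W a b) :
    subst W n k f a = subst W n k f b := by
  rw [subst, subst, rep_eq_of_rel h]

theorem le_comap_subst (W q : Setoid ℕ) (n k : ℕ) (f : ℕ → ℕ) :
    W ≤ q.comap (subst W n k f) := by
  intro a b hab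
  rw [Setoid.comap_rel, subst_eq_of_rel hab]

theorem agree_comap_subst (W : Setoid ℕ) (n k : ℕ) (f : ℕ → ℕ) :
    Agree W (W.comap (subst W n k f)) n := by
  intro a ha b hb
  have h : W.comap (subst W n k f) a b ↔ W (rep W a) (rep W b) := by
    rw [Setoid.comap_rel, subst_of_lt ha, subst_of_lt hb]
  rw [h]
  exact ⟨fun h => W.trans (W.symm (rel_rep W a)) (W.trans h (rel_rep W b)),
    fun h => W.trans (rel_rep W a) (W.trans h (W.symm (rel_rep W b)))⟩

theorem subst_lt {W : Setoid ℕ} {n k : ℕ} {f : ℕ → ℕ} (hf : ∀ c, f c < n) {a : ℕ} (ha : a < k) :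
    subst W n k f a < n := by
  by_cases h : n ≤ rep W a
  · rw [subst_of_le h ha]; exact hf _
  · rw [subst_of_rep_lt (not_le.1 h)]; exact not_le.1 h

theorem comap_subst_rel {W : Setoid ℕ} {n k : ℕ} {f : ℕ → ℕ} (hf : ∀ c, f c < n)
    {a : ℕ} (ha : a < k) :
    W.comap (subst W n k f) a (subst W n k f a) := by
  rw [Setoid.comap_rel, subst_of_lt (subst_lt hf ha)]
  exact rel_rep W _

theorem noNew_comap_subst {W : Setoid ℕ} {n k : ℕ} {f : ℕ → ℕ} (hf : ∀ c, f c < n) :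
    NoNew (W.comap (subst W n k f)) n k := fun _ hd =>
  ⟨_, subst_lt hf hd, Setoid.symm' _ (comap_subst_rel hf hd)⟩

theorem isFirst_comap_subst {W : Setoid ℕ} {n k : ℕ} {f : ℕ → ℕ} (hf : ∀ c, f c < n)
    (hnk : n ≤ k) (hk : IsFirst W k) :
    IsFirst (W.comap (subst W n k f)) k := by
  intro j hj h
  have h1 : subst W n k f k = k := by
    rw [subst, hk.rep_eq, if_neg (by omega)]
  rw [Setoid.comap_rel, h1] at h
  exact hk _ ((subst_lt hf hj).trans_le hnk) h

theorem comap_subst_le {W : Setoid ℕ} {n k : ℕ} {f : ℕ → ℕ} (hf : ∀ c, f c < n)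
    (hnk : n ≤ k) : W.comap (subst W n k f) ≤ W ⊔ low ⊤ k := by
  have key : ∀ a, (W ⊔ low ⊤ k) a (subst W n k f a) := by
    intro a
    have h1 : (W ⊔ low ⊤ k) a (rep W a) := le_sup_left (a := W) (rel_rep W a)
    unfold subst
    split_ifs with h
    · exact Setoid.trans' _ h1
        (le_sup_right (a := W) (Or.inr ⟨h.2, (hf _).trans_le hnk, trivial⟩))
    · exact h1
  intro a b hab
  exact Setoid.trans' _ (key a)
    (Setoid.trans' _ (le_sup_left (a := W) hab) (Setoid.symm' _ (key b)))

theorem Agree.of_map {r q : Setoid ℕ} {n k : ℕ} {φ : ℕ → ℕ} (h : Agree r q n)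
    (hφ : ∀ a < k, φ a < n) (hr : ∀ a < k, r a (φ a)) (hq : ∀ a < k, q a (φ a)) :
    Agree r q k := by
  intro a ha b hb
  constructor
  · intro hab
    have h1 := (h _ (hφ a ha) _ (hφ b hb)).1
      (r.trans (r.symm (hr a ha)) (r.trans hab (hr b hb)))
    exact q.trans (hq a ha) (q.trans h1 (q.symm (hq b hb)))
  · intro hab
    have h1 := (h _ (hφ a ha) _ (hφ b hb)).2
      (q.trans (q.symm (hq a ha)) (q.trans hab (hq b hb)))
    exact r.trans (hr a ha) (r.trans h1 (r.symm (hr b hb)))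

instance finite_setoid_fin (n : ℕ) : Finite (Setoid (Fin n)) :=
  Finite.of_injective (fun r : Setoid (Fin n) => fun a b => r a b) (by
    intro r q h
    exact Setoid.ext fun a b => iff_of_eq (congrFun (congrFun h a) b))

theorem InfClasses.exists_index {W : Setoid ℕ} (hW : InfClasses W) (n : ℕ) (ι : Type)
    [Finite ι] [Nonempty ι] :
    ∃ k, n ≤ k ∧ IsFirst W k ∧ ∃ idx : ℕ → ι, ∀ i, ∃ c, n ≤ c ∧ c < k ∧ IsFirst W c ∧
      idx c = i := by
  have hinf : {c | n ≤ c ∧ IsFirst W c}.Infinite := by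
    refine Set.infinite_of_forall_exists_gt fun m => ?_
    obtain ⟨k, hk, hl⟩ := hW (max n (m + 1))
    exact ⟨k, ⟨by omega, hl⟩, by omega⟩
  obtain ⟨N, ⟨e⟩⟩ := Finite.exists_equiv_fin ι
  have := hinf.to_subtype
  let b : ι → ℕ := fun i => Infinite.natEmbedding {c | n ≤ c ∧ IsFirst W c} (e i)
  have hb : Function.Injective b := by
    intro i j hij
    exact e.injective (Fin.ext ((Infinite.natEmbedding _).injective (Subtype.ext hij)))
  have hb' : ∀ i, n ≤ b i ∧ IsFirst W (b i) := fun i =>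
    (Infinite.natEmbedding {c | n ≤ c ∧ IsFirst W c} (e i)).2
  obtain ⟨M, hM⟩ := (Set.finite_range b).bddAbove
  obtain ⟨k, hk, hl⟩ := hW (max n (M + 1))
  refine ⟨k, by omega, hl, Function.invFun b, fun i => ⟨b i, (hb' i).1, ?_, (hb' i).2,
    Function.leftInverse_invFun hb i⟩⟩
  have := hM (Set.mem_range_self i)
  omega

/-- If `W` has no line in `D`, then some end-extension without new classes has no reduction
in `D`. -/
theorem exists_avoiding {X W : Setoid ℕ} {D : Setoid ℕ → ℕ → Prop} {ns np : ℕ}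
    (hD : ∀ ρ ρ' l, Agree ρ ρ' l → D ρ l → D ρ' l)
    (hns : 0 < ns) (hnp : ns ≤ np) (hW : InfClasses W)
    (hno : ∀ ρ l, ns ≤ l → Agree X ρ ns → OneNew ρ ns l → IsFirst W l → LeOn W ρ l →
      ¬ Line X D ns ρ l) :
    ∃ nq Y, np ≤ nq ∧ W ≤ Y ∧ Y ≤ W ⊔ low ⊤ nq ∧ Agree W Y np ∧ IsFirst Y nq ∧ NoNew Y np nq ∧
      ∀ ρ, Agree X ρ ns → LeOn Y ρ nq → NoNew ρ ns nq → ¬ D ρ nq := by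
  by_contra hcon
  have : Nonempty (Fin ns) := ⟨⟨0, hns⟩⟩
  obtain ⟨ι, _, hι⟩ := Combinatorics.Line.exists_mono_in_high_dimension (Fin ns)
    (Setoid (Fin np))
  have hne : Nonempty ι := by
    obtain ⟨l, -⟩ := hι fun _ => ⊤
    exact ⟨l.proper.choose⟩
  obtain ⟨k, hnk, hk, idx, hidx⟩ := hW.exists_index np ι
  have hf : ∀ (w : ι → Fin ns) (c : ℕ), ((w (idx c) : Fin ns) : ℕ) < np := fun w c =>
    (w (idx c)).2.trans_le hnp
  have hbad : ∀ w : ι → Fin ns, ∃ ρ, Agree X ρ ns ∧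
      LeOn (W.comap (subst W np k fun c => (w (idx c) : ℕ))) ρ k ∧ NoNew ρ ns k ∧ D ρ k := by
    intro w
    by_contra hw
    push Not at hw
    exact hcon ⟨k, _, hnk, le_comap_subst W W np k _, comap_subst_le (hf w) hnk,
      agree_comap_subst W np k _, isFirst_comap_subst (hf w) hnk hk, noNew_comap_subst (hf w), hw⟩
  choose R hRX hRle hRnew hRD using hbad
  obtain ⟨l, T, hT⟩ := hι fun w => (R w).comap Fin.val
  have hWR : ∀ w, LeOn W (R w) k := fun w => (leOn_of_le (le_comap_subst W W np k _) k).trans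
    (hRle w)
  set τ := R (l ⟨0, hns⟩) with hτ
  have hτrep : ∀ a < k, τ a (rep W a) := fun a ha =>
    hWR _ a ha _ ((rep_le W a).trans_lt ha) (rel_rep W a)
  set g : ℕ → ℕ := fun c => (l.idxFun (idx c)).elim np fun j => (j : ℕ) with hg
  set ρ := (low τ np).comap (subst W np k g) with hρ
  have hρτ : Agree ρ τ np := by
    intro a ha b hb
    rw [hρ, Setoid.comap_rel, subst_of_lt ha, subst_of_lt hb,
      ← agree_low τ np _ ((rep_le W a).trans_lt ha) _ ((rep_le W b).trans_lt hb)]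
    have h1 := hτrep a (by omega)
    have h2 := hτrep b (by omega)
    exact ⟨fun h => τ.trans h1 (τ.trans h (τ.symm h2)),
      fun h => τ.trans (τ.symm h1) (τ.trans h h2)⟩
  have hρX : Agree X ρ ns := (hRX _).trans (hρτ.mono hnp).symm
  have hWρ : LeOn W ρ k := leOn_of_le (le_comap_subst W _ np k g) k
  have hsome : ∀ a < k, np ≤ rep W a → ∀ j, l.idxFun (idx (rep W a)) = some j → ρ a (j : ℕ) := by
    intro a ha har j hj
    have hjn : (j : ℕ) < np := j.2.trans_le hnp
    have h1 : subst W np k g a = j := by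
      rw [subst_of_le har ha, hg]
      simp [hj]
    rw [hρ, Setoid.comap_rel, h1, subst_of_lt hjn,
      ← agree_low τ np _ hjn _ ((rep_le W j).trans_lt hjn)]
    exact hτrep j (by omega)
  have hnone : ∀ a < k, np ≤ rep W a → l.idxFun (idx (rep W a)) = none →
      subst W np k g a = np := by
    intro a ha har hj
    rw [subst_of_le har ha, hg]
    simp [hj]
  obtain ⟨i₀, hi₀⟩ := l.proper
  obtain ⟨a₀, ha₀, ha₀k, ha₀f, rfl⟩ := hidx i₀
  have ha₀s : subst W np k g a₀ = np := by
    refine hnone a₀ ha₀k ?_ ?_ <;> rw [ha₀f.rep_eq]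
    · exact ha₀
    · exact hi₀
  have hvar : ∀ a < k, np ≤ rep W a → l.idxFun (idx (rep W a)) = none → ρ a₀ a := by
    intro a ha har hj
    rw [hρ, Setoid.comap_rel, ha₀s, hnone a ha har hj]
  have hlow : NoNew ρ ns np := by
    intro d hd
    obtain ⟨c, hc, hcd⟩ := hRnew (l ⟨0, hns⟩) d (by omega)
    exact ⟨c, hc, (hρτ c (by omega) d hd).2 hcd⟩
  refine hno ρ k (hnp.trans hnk) hρX ?_ hk hWρ ?_
  · refine ⟨a₀, ha₀k, hnp.trans ha₀, fun c hc h => ?_, fun d hd => ?_⟩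
    · rw [hρ, Setoid.comap_rel, ha₀s, subst_of_lt (hc.trans_le hnp)] at h
      have := rep_le W c
      rcases h with h | ⟨-, h, -⟩ <;> omega
    · by_cases hdr : np ≤ rep W d
      · cases hj : l.idxFun (idx (rep W d)) with
        | none => exact Or.inr (hvar d hd hdr hj)
        | some j => exact Or.inl ⟨j, j.2, ρ.symm (hsome d hd hdr j hj)⟩
      · obtain ⟨c, hc, hcd⟩ := hlow (rep W d) (not_le.1 hdr)
        exact Or.inl ⟨c, hc, ρ.trans hcd
          (hWρ _ ((rep_le W d).trans_lt hd) d hd (W.symm (rel_rep W d)))⟩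
  · intro ρ' hρ'X hρρ' hρ'new
    obtain ⟨j, hj, hja⟩ := hρ'new a₀ ha₀k
    let w := l ⟨j, hj⟩
    refine hD (R w) ρ' k ?_ (hRD w)
    have hcol : Agree (R w) τ np := by
      intro a ha b hb
      have h1 : (R w).comap Fin.val = τ.comap (Fin.val : Fin np → ℕ) :=
        (hT ⟨j, hj⟩).trans (hT ⟨0, hns⟩).symm
      have h2 := congrArg (fun r : Setoid (Fin np) => r ⟨a, ha⟩ ⟨b, hb⟩) h1
      simpa [Setoid.comap_rel] using h2
    have hρρ'' : Agree ρ ρ' np := hlow.agree hnp (hρρ'.mono hnk) (hρX.symm.trans hρ'X)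
    refine ((hcol.trans hρτ.symm).trans hρρ'').of_map (fun a ha => subst_lt (W := W) (hf w) ha)
      (fun a ha => ?_) fun a ha => ?_
    · exact hRle w a ha _ ((subst_lt (hf w) ha).trans_le hnk) (comap_subst_rel (hf w) ha)
    · by_cases har : np ≤ rep W a
      · rw [subst_of_le har ha]
        have hwi : w (idx (rep W a)) = (l.idxFun (idx (rep W a))).getD ⟨j, hj⟩ := rfl
        rw [hwi]
        cases hj' : l.idxFun (idx (rep W a)) with
        | none => exact ρ'.trans (ρ'.symm (hρρ' a₀ ha₀k a ha (hvar a ha har hj'))) (ρ'.symm hja)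
        | some j' => exact hρρ' a ha _ (by simp; omega) (hsome a ha har j' hj')
      · rw [subst_of_rep_lt (not_le.1 har)]
        have := (rep_le W a).trans_lt ha
        exact hρρ' a ha _ this (hWρ a ha _ this (rel_rep W a))

/-- The properties of (the equivalence relations of) a game filter used in the main argument. -/
structure IsDiagonalFilter (F : Set (Setoid ℕ)) : Prop where
  infClasses : ∀ x ∈ F, InfClasses x
  anti : ∀ x ∈ F, ∀ y ≤ x, y ∈ F
  sup_low_mem : ∀ x ∈ F, ∀ n, x ⊔ low ⊤ n ∈ F
  diagonalize : ∀ X ∈ F, ∀ (ns : ℕ) (R : ℕ → Setoid ℕ → Prop),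
    (∀ np W, W ∈ F → X ≤ W → Agree X W ns → ns ≤ np →
      ∃ nq Y, np ≤ nq ∧ Y ∈ F ∧ W ≤ Y ∧ Agree W Y np ∧ IsFirst Y nq ∧ NoNew Y np nq ∧ R nq Y) →
    ∃ Z ∈ F, X ≤ Z ∧ Agree X Z ns ∧ ∀ k, ns ≤ k → IsFirst Z k → ∃ Y ≤ Z, R k Y

theorem exists_forall_of_finite {F : Set (Setoid ℕ)} {ι : Type} [Finite ι]
    {P : ι → Setoid ℕ → Prop} (hP : ∀ i Y Y', Y ≤ Y' → P i Y → P i Y') {W : Setoid ℕ} {n : ℕ}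
    (hW : W ∈ F)
    (hstep : ∀ i, ∀ Y ∈ F, W ≤ Y → Agree W Y n → ∃ Y' ∈ F, Y ≤ Y' ∧ Agree Y Y' n ∧ P i Y') :
    ∃ Y ∈ F, W ≤ Y ∧ Agree W Y n ∧ ∀ i, P i Y := by
  classical
  cases nonempty_fintype ι
  have key : ∀ S : Finset ι, ∃ Y ∈ F, W ≤ Y ∧ Agree W Y n ∧ ∀ i ∈ S, P i Y := by
    intro S
    induction S using Finset.induction_on with
    | empty => exact ⟨W, hW, le_rfl, Agree.refl W n, by simp⟩
    | insert i S _ ih =>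
      obtain ⟨Y, hY, hWY, hA, hS⟩ := ih
      obtain ⟨Y', hY', hYY', hA', hi⟩ := hstep i Y hY hWY hA
      refine ⟨Y', hY', hWY.trans hYY', hA.trans hA', fun j hj => ?_⟩
      rcases Finset.mem_insert.1 hj with rfl | hj
      · exact hi
      · exact hP j Y Y' hYY' (hS j hj)
  obtain ⟨Y, hY, h1, h2, h3⟩ := key Finset.univ
  exact ⟨Y, hY, h1, h2, fun i => h3 i (Finset.mem_univ i)⟩

/-- No line in `D` that is coarser than `Y` end-extends `τ` restricted to `{0, …, n - 1}`. -/
def NoLineAbove (X : Setoid ℕ) (D : Setoid ℕ → ℕ → Prop) (ns : ℕ) (τ : Setoid ℕ) (n : ℕ)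
    (Y : Setoid ℕ) : Prop :=
  ∀ ρ l, n ≤ l → Agree τ ρ n → NoNew ρ n l → IsFirst Y l → LeOn Y ρ l → ¬ Line X D ns ρ l

theorem NoLineAbove.mono {X : Setoid ℕ} {D : Setoid ℕ → ℕ → Prop} {ns : ℕ} {τ : Setoid ℕ}
    {n : ℕ} {Y Y' : Setoid ℕ} (h : NoLineAbove X D ns τ n Y) (hY : Y ≤ Y') :
    NoLineAbove X D ns τ n Y' := fun ρ l hl hA hN hf hle =>
  h ρ l hl hA hN (hf.anti hY) ((leOn_of_le hY l).trans hle)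

theorem NoLineAbove.congr {X : Setoid ℕ} {D : Setoid ℕ → ℕ → Prop} {ns : ℕ} {τ τ' : Setoid ℕ}
    {n : ℕ} {Y : Setoid ℕ} (h : NoLineAbove X D ns τ n Y) (hτ : Agree τ τ' n) :
    NoLineAbove X D ns τ' n Y := fun ρ l hl hA => h ρ l hl (hτ.trans hA)

/-- Failure of the conclusion of the main theorem, for equivalence relations. -/
def LinesAvoidable (F : Set (Setoid ℕ)) (X : Setoid ℕ) (D : Setoid ℕ → ℕ → Prop) (ns : ℕ) :
    Prop :=
  ∀ τ n, ns ≤ n → Agree X τ ns → OneNew τ ns n → IsFirst X n → LeOn X τ n →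
    ∀ Y ∈ F, X ≤ Y → Agree τ Y n → ∃ Z ∈ F, Y ≤ Z ∧ Agree τ Z n ∧ NoLineAbove X D ns τ n Z

section

variable {F : Set (Setoid ℕ)} {X : Setoid ℕ} {D : Setoid ℕ → ℕ → Prop} {ns : ℕ}

theorem IsDiagonalFilter.glue_mem (hF : IsDiagonalFilter F) {Y τ : Setoid ℕ} {n : ℕ} (hY : Y ∈ F)
    (h : LeOn Y τ n) : glue Y τ n h ∈ F :=
  hF.anti _ (hF.sup_low_mem Y hY n) _ (glue_le h)

theorem exists_noLineAbove (hF : IsDiagonalFilter F) (H : LinesAvoidable F X D ns)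
    {τ Y : Setoid ℕ} {n : ℕ} (hn : ns ≤ n) (hXτ : Agree X τ ns) (hτ : OneNew τ ns n)
    (hfirst : IsFirst X n) (hY : Y ∈ F) (hXY : X ≤ Y) (hle : LeOn Y τ n) :
    ∃ Y' ∈ F, Y ≤ Y' ∧ Agree Y Y' n ∧ NoLineAbove X D ns τ n Y' := by
  obtain ⟨Z, hZ, hYZ, hτZ, hno⟩ := H τ n hn hXτ hτ hfirst
    ((leOn_of_le hXY n).trans hle) (glue Y τ n hle) (hF.glue_mem hY hle)
    (hXY.trans (le_glue hle)) (agree_glue hle)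
  have hYZ' : Y ≤ Z := (le_glue hle).trans hYZ
  refine ⟨split Y Z n, hF.anti Z hZ _ (split_le hYZ' n), le_split hYZ' n, agree_split Y Z n, ?_⟩
  intro ρ l hl hA hN hf hle'
  exact hno ρ l hl hA hN (hf.of_split hYZ' hl) (hle'.of_split hYZ' (hτZ.symm.trans hA))

/-- If lines in `D` are avoidable, then some member of the filter has no line in `D` at all. -/
theorem exists_lineFree (hF : IsDiagonalFilter F) (hX : X ∈ F) (H : LinesAvoidable F X D ns) :
    ∃ Z ∈ F, X ≤ Z ∧ Agree X Z ns ∧ ∀ ρ l, ns ≤ l → Agree X ρ ns → OneNew ρ ns l → IsFirst Z l →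
      LeOn Z ρ l → ¬ Line X D ns ρ l := by
  have key := hF.diagonalize X hX ns
    fun k Y => ∀ ρ, Agree X ρ ns → OneNew ρ ns k → LeOn Y ρ k → ¬ Line X D ns ρ k
  refine (key ?_).elim ?_ <;> clear key
  rotate_left
  · rintro Z ⟨hZ, hXZ, hA, hR⟩
    refine ⟨Z, hZ, hXZ, hA, fun ρ l hl hXρ hone hf hle => ?_⟩
    obtain ⟨Y, hYZ, hY⟩ := hR l hl hf
    exact hY ρ hXρ hone ((leOn_of_le hYZ l).trans hle)
  · intro np W hW hXW hXWn hnp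
    obtain ⟨n, hn, hnf, hnew⟩ := (hF.infClasses W hW).exists_next np
    let P : Setoid (Fin n) → Setoid ℕ → Prop := fun T Y => ∀ τ : Setoid ℕ, τ.comap Fin.val = T →
      Agree X τ ns → OneNew τ ns n → LeOn W τ n → NoLineAbove X D ns τ n Y
    have hstep : ∀ T, ∀ Y ∈ F, W ≤ Y → Agree W Y n → ∃ Y' ∈ F, Y ≤ Y' ∧ Agree Y Y' n ∧ P T Y' := by
      intro T Y hY hWY hA
      by_cases hT : ∃ τ : Setoid ℕ, τ.comap Fin.val = T ∧ Agree X τ ns ∧ OneNew τ ns n ∧ LeOn W τ n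
      · obtain ⟨τ, rfl, h1, h2, h3⟩ := hT
        obtain ⟨Y', hY', h4, h5, h6⟩ := exists_noLineAbove hF H (hnp.trans hn) h1 h2
          (hnf.anti hXW) hY (hXW.trans hWY) (hA.symm.leOn.trans h3)
        refine ⟨Y', hY', h4, h5, fun τ' hτ' _ _ _ => h6.congr fun a ha b hb => ?_⟩
        have h := congrArg (fun r : Setoid (Fin n) => r ⟨a, ha⟩ ⟨b, hb⟩) hτ'
        exact (iff_of_eq h).symm
      · exact ⟨Y, hY, le_rfl, Agree.refl _ _,
          fun τ h1 h2 h3 h4 => absurd ⟨τ, h1, h2, h3, h4⟩ hT⟩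
    obtain ⟨Y, hY, hWY, hA, hP⟩ := exists_forall_of_finite (P := P)
      (fun T Y Y' hYY' h τ h1 h2 h3 h4 => (h τ h1 h2 h3 h4).mono hYY') hW hstep
    obtain ⟨nq, hnq, hqf, hqnew⟩ := (hF.infClasses Y hY).exists_next n
    have hnone : ∀ j, np ≤ j → j < nq → ¬ IsFirst Y j := by
      intro j hj hjq hf
      by_cases h : j < n
      · exact hnew j hj h (hf.anti hWY)
      · exact hqnew j (not_lt.1 h) hjq hf
    refine ⟨nq, Y, hn.trans hnq, hY, hWY, hA.mono hn, hqf,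
      noNew_of_forall_not_isFirst hnone, fun ρ hXρ hone hle => ?_⟩
    obtain ⟨a, ha, hna, hac, had⟩ := hone
    have hra : ρ a (rep Y a) := hle a ha _ ((rep_le Y a).trans_lt ha) (rel_rep Y a)
    have hrn : rep Y a < np := by
      by_contra h
      exact hnone _ (not_lt.1 h) ((rep_le Y a).trans_lt ha) (isFirst_rep Y a)
    have hone' : OneNew ρ ns n := by
      refine ⟨rep Y a, hrn.trans_le hn, ?_, fun c hc h => hac c hc (ρ.trans h (ρ.symm hra)),
        fun d hd => ?_⟩
      · by_contra h
        exact hac _ (not_le.1 h) (ρ.symm hra)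
      · exact (had d (hd.trans_le hnq)).imp_right fun h => ρ.trans (ρ.symm hra) h
    refine hP _ ρ rfl hXρ hone' ((leOn_of_le hWY n).trans (hle.mono hnq)) ρ nq hnq
      (Agree.refl _ _) ?_ hqf hle
    exact (noNew_of_forall_not_isFirst hqnew).mono hnq hle

theorem not_linesAvoidable_zero (hF : IsDiagonalFilter F) (hX : X ∈ F) :
    ¬ LinesAvoidable F X D 0 := by
  intro H
  obtain ⟨n, hn, hf⟩ := hF.infClasses X hX 1
  have hle : LeOn X ⊤ n := fun _ _ _ _ _ => trivial
  obtain ⟨Z, hZ, -, hA, hno⟩ := H ⊤ n (Nat.zero_le n) (fun a ha => absurd ha (Nat.not_lt_zero a))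
    ⟨0, hn, le_rfl, fun c hc => absurd hc (Nat.not_lt_zero c), fun d _ => Or.inr trivial⟩ hf hle
    (glue X ⊤ n hle) (hF.glue_mem hX hle) (le_glue hle) (agree_glue hle)
  obtain ⟨l, hl, hlf⟩ := hF.infClasses Z hZ n
  refine hno ⊤ l hl (Agree.refl _ _) (fun d _ => ⟨0, hn, trivial⟩) hlf
    (fun _ _ _ _ _ => trivial) fun ρ' _ _ hN => ?_
  obtain ⟨c, hc, -⟩ := hN 0 (by omega)
  exact absurd hc (Nat.not_lt_zero c)

theorem not_linesAvoidable (hF : IsDiagonalFilter F) (hX : X ∈ F)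
    (hD : ∀ ρ ρ' l, Agree ρ ρ' l → D ρ l → D ρ' l)
    (hdense : ∀ Z ∈ F, X ≤ Z → Agree X Z ns → ∃ ρ l, ns ≤ l ∧ Agree X ρ ns ∧ NoNew ρ ns l ∧
      IsFirst Z l ∧ LeOn Z ρ l ∧ D ρ l) :
    ¬ LinesAvoidable F X D ns := by
  rcases Nat.eq_zero_or_pos ns with rfl | hns
  · exact not_linesAvoidable_zero hF hX
  intro H
  obtain ⟨V, hV, hXV, hXVn, hfree⟩ := exists_lineFree hF hX H
  have key := hF.diagonalize V hV ns
    fun k Y => ∀ ρ, Agree X ρ ns → LeOn Y ρ k → NoNew ρ ns k → ¬ D ρ k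
  refine (key ?_).elim ?_ <;> clear key
  rotate_left
  · rintro Z ⟨hZ, hVZ, hVZn, hR⟩
    obtain ⟨ρ, l, hl, hXρ, hN, hf, hle, hDρ⟩ := hdense Z hZ (hXV.trans hVZ) (hXVn.trans hVZn)
    obtain ⟨Y, hYZ, hY⟩ := hR l hl hf
    exact hY ρ hXρ ((leOn_of_le hYZ l).trans hle) hN hDρ
  · intro np W hW hVW _ hnp
    obtain ⟨nq, Y, h1, h2, h3, h4, h5, h6, h7⟩ := exists_avoiding hD hns hnp (hF.infClasses W hW)
      fun ρ l hl hXρ hone hf hle =>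
        hfree ρ l hl hXρ hone (hf.anti hVW) ((leOn_of_le hVW l).trans hle)
    exact ⟨nq, Y, h1, hF.anti _ (hF.sup_low_mem W hW nq) _ h3, h2, h4, h5, h6, h7⟩

end

/- ### Partitions as equivalence relations -/

/-- The partition of `A` into the traces of the classes of `r`. -/
def blk (r : Setoid ℕ) (A : Set ℕ) : Set (Set ℕ) := {b | ∃ a ∈ A, b = {c | c ∈ A ∧ r a c}}

theorem blk_congr {r q : Setoid ℕ} {A : Set ℕ} (h : ∀ a ∈ A, ∀ b ∈ A, r a b ↔ q a b) :
    blk r A = blk q A := by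
  have key : ∀ a ∈ A, {c | c ∈ A ∧ r a c} = {c | c ∈ A ∧ q a c} := fun a ha =>
    Set.ext fun c => and_congr_right fun hc => h a ha c hc
  ext b
  exact ⟨fun ⟨a, ha, hb⟩ => ⟨a, ha, hb.trans (key a ha)⟩,
    fun ⟨a, ha, hb⟩ => ⟨a, ha, hb.trans (key a ha).symm⟩⟩

theorem blk_congr_of_agree {r q : Setoid ℕ} {n : ℕ} (h : Agree r q n) :
    blk r (Set.Iio n) = blk q (Set.Iio n) := blk_congr h

theorem pdom_blk (r : Setoid ℕ) (A : Set ℕ) : pdom (blk r A) = A := by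
  ext c
  constructor
  · rintro ⟨b, ⟨a, -, rfl⟩, hc⟩
    exact hc.1
  · exact fun hc => ⟨_, ⟨c, hc, rfl⟩, hc, r.refl c⟩

theorem isPartition_blk (r : Setoid ℕ) (A : Set ℕ) : IsPartition (blk r A) := by
  constructor
  · rintro b ⟨a, ha, rfl⟩
    exact ⟨a, ha, r.refl a⟩
  · rintro b ⟨a, ha, rfl⟩ c ⟨a', ha', rfl⟩ hne
    rw [Set.disjoint_left]
    rintro x ⟨hx, h1⟩ ⟨-, h2⟩
    have haa' : r a a' := r.trans h1 (r.symm h2)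
    exact hne (Set.ext fun y => and_congr_right fun _ =>
      ⟨fun h => r.trans (r.symm haa') h, fun h => r.trans haa' h⟩)

/-- Lying in the same blocks of `P`. -/
def toSetoid (P : Set (Set ℕ)) : Setoid ℕ where
  r a b := ∀ p ∈ P, a ∈ p ↔ b ∈ p
  iseqv :=
    { refl := fun _ _ _ => Iff.rfl
      symm := fun h p hp => (h p hp).symm
      trans := fun h h' p hp => (h p hp).trans (h' p hp) }

theorem IsPartition.blk_toSetoid {P : Set (Set ℕ)} (h : IsPartition P) :
    blk (toSetoid P) (pdom P) = P := by
  have key : ∀ p ∈ P, ∀ a ∈ p, {c | c ∈ pdom P ∧ toSetoid P a c} = p := by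
    intro p hp a ha
    ext c
    constructor
    · exact fun hc => (hc.2 p hp).1 ha
    · refine fun hc => ⟨⟨p, hp, hc⟩, fun q hq => ?_⟩
      by_cases hpq : p = q
      · subst hpq
        exact iff_of_true ha hc
      · have hd := Set.disjoint_left.1 (h.2 p hp q hq hpq)
        exact iff_of_false (hd ha) (hd hc)
  ext b
  constructor
  · rintro ⟨a, ⟨p, hp, ha⟩, rfl⟩
    rwa [key p hp a ha]
  · intro hb
    obtain ⟨a, ha⟩ := h.1 b hb
    exact ⟨a, ⟨b, hb, ha⟩, (key b hb a ha).symm⟩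

theorem InfPart.blk_toSetoid {X : Set (Set ℕ)} (h : InfPart X) :
    blk (toSetoid X) Set.univ = X := by
  rw [← h.2.1]
  exact h.1.blk_toSetoid

theorem FinPart.exists_blk {s : Set (Set ℕ)} (h : FinPart s) : ∃ r n, s = blk r (Set.Iio n) := by
  obtain ⟨hP, n, hn⟩ := h
  refine ⟨toSetoid s, n, ?_⟩
  rw [← hn]
  exact hP.blk_toSetoid.symm

theorem finPart_blk (r : Setoid ℕ) (n : ℕ) : FinPart (blk r (Set.Iio n)) :=
  ⟨isPartition_blk r _, n, pdom_blk r _⟩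

theorem segment_blk {r q : Setoid ℕ} {A B : Set ℕ} :
    Segment (blk r A) (blk q B) ↔ A ⊆ B ∧ ∀ a ∈ A, ∀ b ∈ A, r a b ↔ q a b := by
  unfold Segment
  rw [pdom_blk]
  constructor
  · intro h
    have key : ∀ a ∈ A, a ∈ B ∧ ∀ b ∈ A, r a b ↔ q a b := by
      intro a ha
      obtain ⟨_, ⟨c, hc, rfl⟩, he⟩ := h _ ⟨a, ha, rfl⟩
      have h1 : ∀ b ∈ A, r a b ↔ b ∈ B ∧ q c b := by
        intro b hb
        have := Set.ext_iff.1 he b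
        simp only [Set.mem_ofPred_eq, Set.mem_inter_iff] at this
        tauto
      have h2 := (h1 a ha).1 (r.refl a)
      refine ⟨h2.1, fun b hb => ?_⟩
      constructor
      · exact fun hab => q.trans (q.symm h2.2) ((h1 b hb).1 hab).2
      · intro hab
        obtain ⟨_, ⟨d, hd, rfl⟩, he'⟩ := h _ ⟨b, hb, rfl⟩
        have hbB : b ∈ B := by
          have := (Set.ext_iff.1 he' b).1 ⟨hb, r.refl b⟩
          exact this.1.1
        exact (h1 b hb).2 ⟨hbB, q.trans h2.2 hab⟩
    exact ⟨fun a ha => (key a ha).1, fun a ha => (key a ha).2⟩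
  · rintro ⟨hAB, h⟩ _ ⟨a, ha, rfl⟩
    refine ⟨_, ⟨a, hAB ha, rfl⟩, ?_⟩
    ext c
    simp only [Set.mem_ofPred_eq, Set.mem_inter_iff]
    constructor
    · exact fun hc => ⟨⟨hAB hc.1, (h a ha c hc.1).1 hc.2⟩, hc.1⟩
    · exact fun hc => ⟨hc.2, (h a ha c hc.2).2 hc.1.2⟩

theorem segment_blk_Iio {r q : Setoid ℕ} {m n : ℕ} :
    Segment (blk r (Set.Iio m)) (blk q (Set.Iio n)) ↔ m ≤ n ∧ Agree r q m := by
  rw [segment_blk, Set.Iio_subset_Iio_iff]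
  rfl

theorem segment_blk_univ {r q : Setoid ℕ} {m : ℕ} :
    Segment (blk r (Set.Iio m)) (blk q Set.univ) ↔ Agree r q m := by
  rw [segment_blk]
  exact and_iff_right (Set.subset_univ _)

theorem coarser_blk {r q : Setoid ℕ} {A B : Set ℕ} :
    Coarser (blk r A) (blk q B) ↔
      ∀ a ∈ A, a ∈ B → ∀ b ∈ A, b ∈ B → q a b → r a b := by
  unfold Coarser
  rw [pdom_blk, pdom_blk]
  constructor
  · intro h a haA haB b hbA hbB hab
    obtain ⟨S, hS, he⟩ := h _ ⟨a, haA, rfl⟩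
    have h1 : a ∈ ⋃ q ∈ S, q ∩ A := he ▸ ⟨⟨haA, r.refl a⟩, haB⟩
    simp only [Set.mem_iUnion] at h1
    obtain ⟨p, hp, hap⟩ := h1
    obtain ⟨c, hc, rfl⟩ := hS hp
    have h2 : b ∈ ⋃ q ∈ S, q ∩ A := by
      simp only [Set.mem_iUnion]
      exact ⟨_, hp, ⟨hbB, q.trans hap.1.2 hab⟩, hbA⟩
    rw [← he] at h2
    exact h2.1.2
  · rintro h _ ⟨a, ha, rfl⟩
    refine ⟨{p | p ∈ blk q B ∧ ∃ c ∈ p, c ∈ A ∧ r a c}, fun p hp => hp.1, ?_⟩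
    ext c
    simp only [Set.mem_inter_iff, Set.mem_ofPred_eq, Set.mem_iUnion, exists_prop]
    constructor
    · rintro ⟨⟨hcA, hac⟩, hcB⟩
      exact ⟨_, ⟨⟨c, hcB, rfl⟩, c, ⟨hcB, q.refl c⟩, hcA, hac⟩, ⟨hcB, q.refl c⟩, hcA⟩
    · rintro ⟨_, ⟨⟨d, hd, rfl⟩, e, he, heA, hae⟩, hc, hcA⟩
      exact ⟨⟨hcA, r.trans hae (h e heA he.1 c hcA hc.1 (q.trans (q.symm he.2) hc.2))⟩, hc.1⟩

theorem coarser_blk_univ {r q : Setoid ℕ} :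
    Coarser (blk r Set.univ) (blk q Set.univ) ↔ q ≤ r := by
  rw [coarser_blk]
  exact ⟨fun h a b => h a trivial trivial b trivial trivial, fun h a _ _ b _ _ hab => h hab⟩

theorem coarser_blk_Iio_univ {r q : Setoid ℕ} {n : ℕ} :
    Coarser (blk r (Set.Iio n)) (blk q Set.univ) ↔ LeOn q r n := by
  rw [coarser_blk]
  exact ⟨fun h a ha b hb => h a ha trivial b hb trivial, fun h a ha _ b hb _ => h a ha b hb⟩

theorem coarser_blk_Iio {r q : Setoid ℕ} {n : ℕ} :
    Coarser (blk r (Set.Iio n)) (blk q (Set.Iio n)) ↔ LeOn q r n := by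
  rw [coarser_blk]
  exact ⟨fun h a ha b hb => h a ha ha b hb hb, fun h a ha _ b hb _ => h a ha b hb⟩

theorem finBound_blk (r : Setoid ℕ) (n : ℕ) : finBound (blk r (Set.Iio n)) = n := by
  have : {m | pdom (blk r (Set.Iio n)) = Set.Iio m} = {n} := by
    ext m
    rw [Set.mem_ofPred_eq, pdom_blk, Set.Iio_inj, Set.mem_singleton_iff, eq_comm]
  rw [finBound, this, csInf_singleton]

theorem sStar_blk_of_isFirst {r : Setoid ℕ} {n : ℕ} (h : IsFirst r n) :
    sStar (blk r (Set.Iio n)) = blk r (Set.Iio (n + 1)) := by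
  have key : ∀ a < n, {c | c ∈ Set.Iio n ∧ r a c} = {c | c ∈ Set.Iio (n + 1) ∧ r a c} := by
    intro a ha
    ext c
    refine and_congr_left fun hac => ?_
    rw [Set.mem_Iio, Set.mem_Iio]
    have : c ≠ n := fun hc => h a ha (hc ▸ hac)
    omega
  have key' : {n} = {c | c ∈ Set.Iio (n + 1) ∧ r n c} := by
    ext c
    constructor
    · rintro rfl
      exact ⟨Nat.lt_succ_self _, r.refl _⟩
    · rintro ⟨hc, hr⟩
      by_contra hne
      exact h c (lt_of_le_of_ne (Nat.lt_succ_iff.1 hc) hne) (r.symm hr)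
  rw [sStar, finBound_blk]
  ext b
  constructor
  · rintro (rfl | ⟨a, ha, rfl⟩)
    · exact ⟨n, Nat.lt_succ_self n, key'⟩
    · exact ⟨a, Nat.lt_succ_of_lt ha, key a ha⟩
  · rintro ⟨a, ha, rfl⟩
    rcases Nat.lt_succ_iff_lt_or_eq.1 ha with ha | rfl
    · exact Or.inr ⟨a, ha, (key a ha).symm⟩
    · exact Or.inl key'.symm

theorem sStar_blk (r : Setoid ℕ) (n : ℕ) :
    sStar (blk r (Set.Iio n)) = blk (low r n) (Set.Iio (n + 1)) := by
  rw [blk_congr_of_agree (agree_low r n), sStar_blk_of_isFirst (isFirst_low r n)]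

theorem coarser_sStar {r q : Setoid ℕ} {n : ℕ} :
    Coarser (sStar (blk r (Set.Iio n))) (blk q Set.univ) ↔ IsFirst q n ∧ LeOn q r n := by
  rw [sStar_blk, coarser_blk_Iio_univ]
  constructor
  · intro h
    refine ⟨fun j hj hq => ?_, fun a ha b hb hab => ?_⟩
    · rcases h j (by omega) n (by omega) hq with h | ⟨-, h, -⟩ <;> omega
    · exact (agree_low r n a ha b hb).2 (h a (by omega) b (by omega) hab)
  · rintro ⟨hf, hle⟩ a ha b hb hab
    rcases Nat.lt_succ_iff_lt_or_eq.1 ha with ha' | rfl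
    · rcases Nat.lt_succ_iff_lt_or_eq.1 hb with hb' | rfl
      · exact Or.inr ⟨ha', hb', hle a ha' b hb' hab⟩
      · exact absurd hab (hf a ha')
    · rcases Nat.lt_succ_iff_lt_or_eq.1 hb with hb' | rfl
      · exact absurd (q.symm hab) (hf b hb')
      · exact Or.inl rfl

theorem segment_sStar {r q : Setoid ℕ} {m n : ℕ} (hmn : m ≤ n) (h : Agree r q m) :
    Segment (blk r (Set.Iio m)) (sStar (blk q (Set.Iio n))) := by
  rw [sStar_blk, segment_blk_Iio]
  exact ⟨hmn.trans (Nat.le_succ n), h.trans ((agree_low q n).mono hmn)⟩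

theorem pmeet_blk (r q : Setoid ℕ) :
    pmeet (blk r Set.univ) (blk q Set.univ) = blk (r ⊔ q) Set.univ := by
  have hs : ∀ (p : Setoid ℕ) a b, sameBlock (blk p Set.univ) a b ↔ p a b := by
    intro p a b
    constructor
    · rintro ⟨_, ⟨c, -, rfl⟩, h1, h2⟩
      exact p.trans (p.symm h1.2) h2.2
    · exact fun h => ⟨_, ⟨a, trivial, rfl⟩, ⟨trivial, p.refl a⟩, trivial, h⟩
  have he : (fun u v => sameBlock (blk r Set.univ) u v ∨ sameBlock (blk q Set.univ) u v) =
      fun u v => r u v ∨ q u v := by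
    funext u v
    rw [hs, hs]
  have hsup : ∀ a c, (r ⊔ q) a c ↔ Relation.EqvGen (fun u v => r u v ∨ q u v) a c := by
    intro a c
    rw [Setoid.sup_eq_eqvGen]
    rfl
  unfold pmeet blk
  rw [← blk, ← blk, he, pdom_blk, pdom_blk]
  ext b
  simp only [Set.union_self, Set.mem_univ, true_and, hsup]

/-- The blocks are in bijection with the least elements of the classes. -/
theorem blk_eq_image {r : Setoid ℕ} {A : Set ℕ} (hA : IsLowerSet A) :
    blk r A = (fun a => {c | c ∈ A ∧ r a c}) '' {a | a ∈ A ∧ IsFirst r a} := by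
  ext b
  constructor
  · rintro ⟨a, ha, rfl⟩
    refine ⟨rep r a, ⟨hA (rep_le r a) ha, isFirst_rep r a⟩, ?_⟩
    ext c
    exact and_congr_right fun _ => ⟨fun h => r.trans (rel_rep r a) h,
      fun h => r.trans (r.symm (rel_rep r a)) h⟩
  · rintro ⟨a, ha, rfl⟩
    exact ⟨a, ha.1, rfl⟩

theorem injOn_block (r : Setoid ℕ) (A : Set ℕ) :
    Set.InjOn (fun a => {c | c ∈ A ∧ r a c}) {a | a ∈ A ∧ IsFirst r a} := by
  intro a ha b hb hab
  have h : b ∈ {c | c ∈ A ∧ r a c} := by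
    have hab' : {c | c ∈ A ∧ r a c} = {c | c ∈ A ∧ r b c} := hab
    rw [hab']
    exact ⟨hb.1, r.refl b⟩
  rw [← ha.2.rep_eq, ← hb.2.rep_eq, rep_eq_of_rel h.2]

/-- The least elements below `n` of the classes of `r`. -/
def firsts (r : Setoid ℕ) (n : ℕ) : Set ℕ := {a | a ∈ Set.Iio n ∧ IsFirst r a}

theorem firsts_finite (r : Setoid ℕ) (n : ℕ) : (firsts r n).Finite :=
  (Set.finite_Iio n).subset fun _ ha => ha.1

theorem ncard_blk (r : Setoid ℕ) (n : ℕ) : (blk r (Set.Iio n)).ncard = (firsts r n).ncard := by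
  rw [blk_eq_image (isLowerSet_Iio n), (injOn_block r _).ncard_image, firsts]

theorem firsts_subset (r : Setoid ℕ) {m n : ℕ} (h : m ≤ n) : firsts r m ⊆ firsts r n :=
  fun _ ha => ⟨lt_of_lt_of_le ha.1 h, ha.2⟩

theorem NoNew.ncard_eq {r : Setoid ℕ} {k l : ℕ} (h : NoNew r k l) (hkl : k ≤ l) :
    (blk r (Set.Iio l)).ncard = (blk r (Set.Iio k)).ncard := by
  rw [ncard_blk, ncard_blk]
  congr 1
  refine Set.Subset.antisymm (fun a ha => ⟨?_, ha.2⟩) (firsts_subset r hkl)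
  obtain ⟨c, hc, hca⟩ := h a ha.1
  by_contra hak
  exact ha.2 c (hc.trans_le (not_lt.1 hak)) hca

theorem noNew_of_ncard_eq {r : Setoid ℕ} {k l : ℕ} (hkl : k ≤ l)
    (h : (blk r (Set.Iio l)).ncard = (blk r (Set.Iio k)).ncard) : NoNew r k l := by
  rw [ncard_blk, ncard_blk] at h
  have he := Set.eq_of_subset_of_ncard_le (firsts_subset r hkl) h.le (firsts_finite r l)
  intro d hd
  have : rep r d ∈ firsts r k := he ▸ ⟨(rep_le r d).trans_lt hd, isFirst_rep r d⟩
  exact ⟨rep r d, this.1, r.symm (rel_rep r d)⟩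

theorem OneNew.ncard_eq {r : Setoid ℕ} {k l : ℕ} (h : OneNew r k l) (hkl : k ≤ l) :
    (blk r (Set.Iio l)).ncard = (blk r (Set.Iio k)).ncard + 1 := by
  obtain ⟨a, hal, -, hac, had⟩ := h
  have hk : k ≤ rep r a := by
    by_contra hlt
    exact hac _ (not_le.1 hlt) (r.symm (rel_rep r a))
  rw [ncard_blk, ncard_blk,
    ← Set.ncard_insert_of_notMem (a := rep r a) (fun h' => absurd h'.1 (not_lt.2 hk))
      (firsts_finite r k)]
  congr 1
  refine Set.Subset.antisymm (fun d hd => ?_) (Set.insert_subset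
    ⟨(rep_le r a).trans_lt hal, isFirst_rep r a⟩ (firsts_subset r hkl))
  rcases had d hd.1 with ⟨c, hc, hcd⟩ | had
  · right
    refine ⟨?_, hd.2⟩
    by_contra hdk
    exact hd.2 c (hc.trans_le (not_lt.1 hdk)) hcd
  · left
    rw [rep_eq_of_rel had, hd.2.rep_eq]

theorem IsFirst.ncard_blk_succ {r : Setoid ℕ} {n : ℕ} (h : IsFirst r n) :
    (blk r (Set.Iio (n + 1))).ncard = (blk r (Set.Iio n)).ncard + 1 := by
  refine OneNew.ncard_eq ⟨n, Nat.lt_succ_self n, le_rfl, h, fun d hd => ?_⟩ (Nat.le_succ n)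
  rcases Nat.lt_succ_iff_lt_or_eq.1 hd with hd | rfl
  · exact Or.inl ⟨d, hd, r.refl d⟩
  · exact Or.inr (r.refl _)

theorem infPart_blk {r : Setoid ℕ} : InfPart (blk r Set.univ) ↔ InfClasses r := by
  unfold InfPart
  rw [pdom_blk, blk_eq_image isLowerSet_univ, Set.infinite_image_iff (injOn_block r _),
    ← blk_eq_image isLowerSet_univ, and_iff_right (isPartition_blk r _), and_iff_right rfl]
  constructor
  · intro h n
    obtain ⟨k, hk, hnk⟩ := h.exists_gt n
    exact ⟨k, hnk.le, hk.2⟩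
  · intro h
    refine Set.infinite_of_forall_exists_gt fun n => ?_
    obtain ⟨k, hk, hf⟩ := h (n + 1)
    exact ⟨k, ⟨trivial, hf⟩, hk⟩

theorem ellNbhd_blk {r X Y : Setoid ℕ} {n : ℕ} :
    blk Y Set.univ ∈ EllNbhd (blk r (Set.Iio n)) (blk X Set.univ) ↔
      InfClasses Y ∧ Agree r Y n ∧ X ≤ Y := by
  unfold EllNbhd
  rw [Set.mem_ofPred_eq, infPart_blk, segment_blk_univ, coarser_blk_univ]

/- ### Game filters -/

theorem IsPUltrafilter.sup_low_mem {F : Set (Set (Set ℕ))} (hF : IsPUltrafilter F) {x : Setoid ℕ}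
    (hx : blk x Set.univ ∈ F) (n : ℕ) : blk (x ⊔ low ⊤ n) Set.univ ∈ F := by
  have hinf : ∀ w, blk w Set.univ ∈ F → InfClasses (w ⊔ low ⊤ n) := by
    intro w hw m
    obtain ⟨k, hk, hf⟩ := infPart_blk.1 (hF.1.mem_infPart _ hw) (max m n)
    exact ⟨k, (le_max_left m n).trans hk, hf.sup_low ((le_max_right m n).trans hk) ⊤⟩
  let G : Set (Set (Set ℕ)) :=
    {Y | ∃ w y, blk w Set.univ ∈ F ∧ Y = blk y Set.univ ∧ y ≤ w ⊔ low ⊤ n}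
  have hmem : ∀ Y ∈ G, InfPart Y := by
    rintro _ ⟨w, y, hw, rfl, hy⟩
    exact infPart_blk.2 ((hinf w hw).anti hy)
  have hmeet : ∀ X ∈ G, ∀ Y ∈ G, pmeet X Y ∈ G := by
    rintro _ ⟨w, y, hw, rfl, hy⟩ _ ⟨w', y', hw', rfl, hy'⟩
    refine ⟨w ⊔ w', y ⊔ y', pmeet_blk w w' ▸ hF.1.meet_mem _ hw _ hw', pmeet_blk y y', ?_⟩
    exact sup_le (hy.trans (sup_le_sup_right le_sup_left _))
      (hy'.trans (sup_le_sup_right le_sup_right _))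
  have hG : IsPFilter G :=
    { mem_infPart := hmem
      empty_not_mem := fun h => (hmem _ h).2.2 Set.finite_empty
      upward := by
        rintro _ ⟨w, y, hw, rfl, hy⟩ Y hY hle
        rw [← hY.blk_toSetoid, coarser_blk_univ] at hle
        exact ⟨w, toSetoid Y, hw, hY.blk_toSetoid.symm, hle.trans hy⟩
      meet_infPart := fun X hX Y hY => hmem _ (hmeet X hX Y hY)
      meet_mem := hmeet }
  have hFG : F ⊆ G := fun Y hY => by
    have he := (hF.1.mem_infPart Y hY).blk_toSetoid
    exact ⟨toSetoid Y, toSetoid Y, he.symm ▸ hY, he.symm, le_sup_left⟩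
  rw [hF.2 G hG hFG]
  exact ⟨x, _, hx, rfl, le_rfl⟩

/-- A play of the game in which player I answers according to a function `step` on equivalence
relations. -/
theorem GameFilter.exists_play {F : Set (Set (Set ℕ))} (hF : GameFilter F)
    (st : ℕ × Setoid ℕ) (step : ℕ × Setoid ℕ → ℕ × Setoid ℕ)
    (Good : ℕ × Setoid ℕ → Prop) (h0 : Good st)
    (hGood : ∀ p, Good p → blk p.2 Set.univ ∈ F ∧ IsFirst p.2 p.1)
    (hstep : ∀ p w, Good p → blk w Set.univ ∈ F → p.2 ≤ w → Agree p.2 w (p.1 + 1) →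
      Good (step (p.1 + 1, w)) ∧ p.1 + 1 ≤ (step (p.1 + 1, w)).1 ∧ w ≤ (step (p.1 + 1, w)).2 ∧
      Agree w (step (p.1 + 1, w)).2 (p.1 + 1) ∧
      NoNew (step (p.1 + 1, w)).2 (p.1 + 1) (step (p.1 + 1, w)).1) :
    ∃ p : ℕ → ℕ × Setoid ℕ, p 0 = st ∧ (∀ n, Good (p n)) ∧
      (∀ n, (p n).1 + 1 ≤ (p (n + 1)).1 ∧ (p n).2 ≤ (p (n + 1)).2 ∧
        NoNew (p (n + 1)).2 ((p n).1 + 1) (p (n + 1)).1) ∧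
      ∃ z, blk z Set.univ ∈ F ∧ ∀ n, Agree (p n).2 z (p n).1 := by
  by_contra hcon
  let S : List (Set (Set ℕ)) → ℕ × Setoid ℕ :=
    fun l => l.foldl (fun p W => step (p.1 + 1, toSetoid W)) st
  refine hF.2 (fun l => (blk (S l).2 (Set.Iio (S l).1), blk (S l).2 Set.univ)) ?_
  intro t Y Xs hfol
  let p : ℕ → ℕ × Setoid ℕ := fun n => S (List.ofFn fun i : Fin n => Xs i)
  have ht : ∀ n, t n = blk (p n).2 (Set.Iio (p n).1) := fun n => (congrArg Prod.fst (hfol n)).symm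
  have hY : ∀ n, Y n = blk (p n).2 Set.univ := fun n => (congrArg Prod.snd (hfol n)).symm
  have hrec : ∀ n, p (n + 1) = step ((p n).1 + 1, toSetoid (Xs n)) := by
    intro n
    have : (List.ofFn fun i : Fin (n + 1) => Xs i) =
        (List.ofFn fun i : Fin n => Xs i) ++ [Xs n] := by
      rw [List.ofFn_succ_last]
      rfl
    change S _ = _
    rw [this]
    exact List.foldl_append
  have hII : ∀ n, Good (p n) → LegalII F t Y Xs n → blk (toSetoid (Xs n)) Set.univ = Xs n ∧
      blk (toSetoid (Xs n)) Set.univ ∈ F ∧ (p n).2 ≤ toSetoid (Xs n) ∧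
      Agree (p n).2 (toSetoid (Xs n)) ((p n).1 + 1) := by
    intro n hg hl
    have he := hl.2.1.blk_toSetoid
    have h := hl.2
    rw [← he, ht, hY, sStar_blk_of_isFirst (hGood _ hg).2, ellNbhd_blk] at h
    exact ⟨he, he.symm ▸ hl.1, h.2.2, h.2.1⟩
  have hgood : ∀ n, (∀ m < n, LegalII F t Y Xs m) → Good (p n) := by
    intro n
    induction n with
    | zero => exact fun _ => h0
    | succ n ih =>
      intro hl
      have hg := ih fun m hm => hl m (hm.trans n.lt_succ_self)
      obtain ⟨-, h1, h2, h3⟩ := hII n hg (hl n n.lt_succ_self)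
      rw [hrec]
      exact (hstep _ _ hg h1 h2 h3).1
  constructor
  · intro n hl
    have hg := hgood n hl
    obtain ⟨hyF, hfirst⟩ := hGood _ hg
    refine ⟨ht n ▸ finPart_blk _ _, hY n ▸ hyF, ⟨Y n, ?_⟩, ?_⟩
    · rw [ht, hY, sStar_blk_of_isFirst hfirst, ellNbhd_blk]
      exact ⟨infPart_blk.1 (hF.1.1.mem_infPart _ hyF), Agree.refl _ _, le_rfl⟩
    · rintro m rfl
      have hgm := hgood m fun i hi => hl i (hi.trans m.lt_succ_self)
      obtain ⟨he, h1, h2, h3⟩ := hII m hgm (hl m m.lt_succ_self)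
      have hs := hstep _ _ hgm h1 h2 h3
      rw [← hrec] at hs
      obtain ⟨-, hlt, hle, hag, hnn⟩ := hs
      have hfm := (hGood _ hgm).2
      have hag' := h3.trans hag
      refine ⟨?_, ?_, ?_⟩
      · rw [ht, ht, sStar_blk_of_isFirst hfm]
        exact segment_sStar hlt hag'
      · rw [ht, ← he, coarser_sStar]
        exact ⟨hfirst.anti hle, leOn_of_le hle _⟩
      · rw [ht, ht, hnn.ncard_eq hlt, ← blk_congr_of_agree hag', hfm.ncard_blk_succ]
  · intro hl Z hZ hseg hZF
    refine hcon ⟨p, rfl, fun n => hgood n fun m _ => hl m, fun n => ?_, toSetoid Z,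
      hZ.blk_toSetoid.symm ▸ hZF, fun n => ?_⟩
    · have hg := hgood n fun m _ => hl m
      obtain ⟨-, h1, h2, h3⟩ := hII n hg (hl n)
      have hs := hstep _ _ hg h1 h2 h3
      rw [← hrec] at hs
      exact ⟨hs.2.1, h2.trans hs.2.2.1, hs.2.2.2.2⟩
    · have := hseg n
      rwa [ht, ← hZ.blk_toSetoid, segment_blk_univ] at this

theorem GameFilter.diagonalize {F : Set (Set (Set ℕ))} (hF : GameFilter F) {X : Setoid ℕ}
    (hX : blk X Set.univ ∈ F) {ns : ℕ} {R : ℕ → Setoid ℕ → Prop}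
    (hR : ∀ np W, blk W Set.univ ∈ F → X ≤ W → Agree X W ns → ns ≤ np →
      ∃ nq Y, np ≤ nq ∧ blk Y Set.univ ∈ F ∧ W ≤ Y ∧ Agree W Y np ∧ IsFirst Y nq ∧
        NoNew Y np nq ∧ R nq Y) :
    ∃ Z, blk Z Set.univ ∈ F ∧ X ≤ Z ∧ Agree X Z ns ∧
      ∀ k, ns ≤ k → IsFirst Z k → ∃ Y ≤ Z, R k Y := by
  have hR' : ∀ p : ℕ × Setoid ℕ, ∃ q : ℕ × Setoid ℕ,
      blk p.2 Set.univ ∈ F → X ≤ p.2 → Agree X p.2 ns → ns ≤ p.1 →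
      p.1 ≤ q.1 ∧ blk q.2 Set.univ ∈ F ∧ p.2 ≤ q.2 ∧ Agree p.2 q.2 p.1 ∧ IsFirst q.2 q.1 ∧
        NoNew q.2 p.1 q.1 ∧ R q.1 q.2 := by
    intro p
    by_cases h : blk p.2 Set.univ ∈ F ∧ X ≤ p.2 ∧ Agree X p.2 ns ∧ ns ≤ p.1
    · obtain ⟨nq, Y, hq⟩ := hR p.1 p.2 h.1 h.2.1 h.2.2.1 h.2.2.2
      exact ⟨(nq, Y), fun _ _ _ _ => hq⟩
    · exact ⟨p, fun h1 h2 h3 h4 => absurd ⟨h1, h2, h3, h4⟩ h⟩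
  choose step hstep using hR'
  obtain ⟨h1, h2, h3, h4, h5, h6, h7⟩ := hstep (ns, X) hX le_rfl (Agree.refl X ns) le_rfl
  obtain ⟨p, hp0, hgood, hp, z, hzF, hz⟩ := hF.exists_play (step (ns, X)) step
    (fun q => (blk q.2 Set.univ ∈ F ∧ X ≤ q.2 ∧ Agree X q.2 ns) ∧ ns ≤ q.1 ∧ IsFirst q.2 q.1 ∧
      R q.1 q.2) ⟨⟨h2, h3, h4⟩, h1, h5, h7⟩ (fun q hq => ⟨hq.1.1, hq.2.2.1⟩) (by
      rintro q w ⟨⟨-, hXq, hag⟩, hns, -, -⟩ hwF hqw hagw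
      obtain ⟨h1, h2, h3, h4, h5, h6, h7⟩ := hstep (q.1 + 1, w) hwF (hXq.trans hqw)
        (hag.trans (hagw.mono (by omega))) (Nat.le_succ_of_le hns)
      exact ⟨⟨⟨h2, hXq.trans (hqw.trans h3),
        hag.trans ((hagw.mono (by omega)).trans (h4.mono (Nat.le_succ_of_le hns)))⟩,
        (Nat.le_succ_of_le hns).trans h1, h5, h7⟩, h1, h3, h4, h6⟩)
  have hmono : StrictMono fun n => (p n).1 := strictMono_nat_of_lt_succ fun n => (hp n).1
  have hchain : Monotone fun n => (p n).2 := monotone_nat_of_le_succ fun n => (hp n).2.1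
  have hle : ∀ n, (p n).2 ≤ z := by
    intro n a b hab
    let m := n + (a + b + 1)
    have hm : m ≤ (p m).1 := hmono.le_apply
    exact (hz m a (by omega) b (by omega)).1 (hchain (Nat.le_add_right n (a + b + 1)) hab)
  refine ⟨z, hzF, (hgood 0).1.2.1.trans (hle 0),
    (hgood 0).1.2.2.trans ((hz 0).mono (hgood 0).2.1), fun k hk hf => ?_⟩
  suffices h : ∃ n, (p n).1 = k by
    obtain ⟨n, rfl⟩ := h
    exact ⟨_, hle n, (hgood n).2.2.2⟩
  by_contra hne
  push Not at hne
  have hlt : ∀ n, (p n).1 < k := by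
    intro n
    induction n with
    | zero =>
      by_contra hk'
      have hk0 : k < (p 0).1 := lt_of_le_of_ne (not_lt.1 hk') (hne 0).symm
      obtain ⟨c, hc, hck⟩ := (hp0.symm ▸ h6 : NoNew (p 0).2 ns (p 0).1) k hk0
      exact hf c (hc.trans_le hk) (hle 0 hck)
    | succ n ih =>
      by_contra hk'
      obtain ⟨c, hc, hck⟩ := (hp n).2.2 k (lt_of_le_of_ne (not_lt.1 hk') (hne (n + 1)).symm)
      exact hf c (hc.trans_le ih) (hle (n + 1) hck)
  exact absurd (hlt k) (not_lt.2 hmono.le_apply)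

theorem GameFilter.isDiagonalFilter {F : Set (Set (Set ℕ))} (hF : GameFilter F) :
    IsDiagonalFilter {x | blk x Set.univ ∈ F} where
  infClasses _ hx := infPart_blk.1 (hF.1.1.mem_infPart _ hx)
  anti x hx _ hy := hF.1.1.upward _ hx _
    (infPart_blk.2 ((infPart_blk.1 (hF.1.1.mem_infPart (blk x Set.univ) hx)).anti hy))
    (coarser_blk_univ.2 hy)
  sup_low_mem _ hx n := hF.1.sup_low_mem hx n
  diagonalize _ hX _ _ hR := hF.diagonalize hX hR

theorem lemma_l66 (F : Set (Set (Set ℕ))) (hF : GameFilter F)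
    (s X : Set (Set ℕ)) (hs : FinPart s) (hX : X ∈ F) (hsX : Segment s X)
    (D : Set (Set (Set ℕ))) (hD : D ⊆ nsegOmega s s.ncard)
    (hdense : ZeroDense F D s X) :
    ∃ t ∈ nseg s X (s.ncard + 1), ∃ Y ∈ EllNbhd t X, Y ∈ F ∧
      KDense F {u | FinPart u ∧ Segment t u ∧ iseg0 s u ⊆ D} s t Y 1 := by
  obtain ⟨x, rfl⟩ : ∃ x, X = blk x Set.univ := ⟨_, (hF.1.1.mem_infPart X hX).blk_toSetoid.symm⟩
  obtain ⟨σ, ns, rfl⟩ := hs.exists_blk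
  rw [segment_blk_univ] at hsX
  rw [blk_congr_of_agree hsX] at *
  by_contra hcon
  refine not_linesAvoidable (D := fun ρ l => blk ρ (Set.Iio l) ∈ D) (ns := ns)
    hF.isDiagonalFilter hX (fun ρ ρ' l h hρ => blk_congr_of_agree h ▸ hρ) ?_ ?_
  · intro Z hZ hXZ hag
    obtain ⟨u, hu, -, hle⟩ := hdense _ (ellNbhd_blk.2
      ⟨infPart_blk.1 (hF.1.1.mem_infPart _ hZ), hag, hXZ⟩) hZ
    obtain ⟨hfin, hcard, hseg⟩ := hD hu
    obtain ⟨ρ, l, rfl⟩ := hfin.exists_blk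
    rw [segment_blk_Iio] at hseg
    rw [coarser_sStar] at hle
    rw [blk_congr_of_agree hseg.2] at hcard
    exact ⟨ρ, l, hseg.1, hseg.2, noNew_of_ncard_eq hseg.1 hcard, hle.1, hle.2, hu⟩
  · intro τ n hn hag hone hfirst hle Y hY hXY hagY
    have hcardt : (blk τ (Set.Iio n)).ncard = (blk x (Set.Iio ns)).ncard + 1 := by
      rw [hone.ncard_eq hn, blk_congr_of_agree hag]
    have hnot : ¬ KDense F {u | FinPart u ∧ Segment (blk τ (Set.Iio n)) u ∧
        iseg0 (blk x (Set.Iio ns)) u ⊆ D} (blk x (Set.Iio ns)) (blk τ (Set.Iio n))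
        (blk Y Set.univ) 1 := fun hk => hcon ⟨blk τ (Set.Iio n),
      ⟨finPart_blk τ n, hcardt, segment_blk_Iio.2 ⟨hn, hag⟩, coarser_sStar.2 ⟨hfirst, hle⟩⟩,
      blk Y Set.univ,
      ellNbhd_blk.2 ⟨infPart_blk.1 (hF.1.1.mem_infPart _ hY), hagY, hXY⟩, hY, hk⟩
    unfold KDense at hnot
    push Not at hnot
    obtain ⟨Z', hZ', hZF, hempty⟩ := hnot
    obtain ⟨z, rfl⟩ : ∃ z, Z' = blk z Set.univ := ⟨_, hZ'.1.blk_toSetoid.symm⟩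
    rw [ellNbhd_blk] at hZ'
    refine ⟨z, hZF, hZ'.2.2, hZ'.2.1, fun ρ l hl hagρ hnn hf hleρ hline => ?_⟩
    refine Set.eq_empty_iff_forall_notMem.1 hempty (blk ρ (Set.Iio l))
      ⟨⟨finPart_blk ρ l, segment_sStar hl hagρ, coarser_sStar.2 ⟨hf, hleρ⟩, ?_⟩,
        finPart_blk ρ l, segment_blk_Iio.2 ⟨hl, hagρ⟩, ?_⟩
    · rw [hnn.ncard_eq hl, ← blk_congr_of_agree hagρ, hcardt]
    · rintro v ⟨hv, hdom, hseg, hco, hcard⟩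
      obtain ⟨ρ', l', rfl⟩ := hv.exists_blk
      rw [pdom_blk, pdom_blk, Set.Iio_inj] at hdom
      subst hdom
      rw [segment_blk_Iio] at hseg
      rw [blk_congr_of_agree hseg.2] at hcard
      exact hline ρ' hseg.2 (coarser_blk_Iio.1 hco) (noNew_of_ncard_eq hseg.1 hcard)

end DualRamsey
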